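/- Let q ∈ [1,2) and set w(1) = 3 and w(q) = 2 for q ∈ (1,2). There exist positive constants C1, C2, C3 depending only on q such that for every d ∈ ℕ, every finite set Q ⊂ ℤ^d, and every m ≥ C1·|Q|·(log(2|Q|))^{w(q)}, there exist points ξ^1, …, ξ^m ∈ 𝕋^d with C2·‖f‖_q^q ≤ (1/m)·∑_{j=1}^m |f(ξ^j)|^q ≤ C3·‖f‖_q^q for all trigonometric polynomials f ∈ T(Q). -/

import Mathlib

noncomputable section
open MeasureTheory

/-- The fundamental cell `[0, 2π)^d` of the torus `𝕋^d`. -/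
def torusCell (d : ℕ) : Set (Fin d → ℝ) := Set.univ.pi fun _ => Set.Ico 0 (2 * Real.pi)

/-- Normalized Lebesgue (probability) measure on the torus `𝕋^d = [0,2π)^d`. -/
def torusMeasure (d : ℕ) : Measure (Fin d → ℝ) :=
  (ENNReal.ofReal ((2 * Real.pi) ^ d))⁻¹ • (volume.restrict (torusCell d))

/-- The `L_q` norm on the torus with respect to the normalized Lebesgue measure. -/
def torusLq (d : ℕ) (q : ℝ) {E : Type*} [NormedAddCommGroup E] (f : (Fin d → ℝ) → E) : ℝ :=
  (∫ x, ‖f x‖ ^ q ∂(torusMeasure d)) ^ (1 / q)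

section Part1

def sgn (b : Bool) : ℝ := if b then 1 else -1

theorem sum_signs_exp {n : ℕ} (v : Fin n → ℝ) :
    ∑ b : Fin n → Bool, Real.exp (∑ j, sgn (b j) * v j) ≤
      2 ^ n * Real.exp ((∑ j, v j ^ 2) / 2) := by
  have h1 : ∀ b : Fin n → Bool, Real.exp (∑ j, sgn (b j) * v j) =
      ∏ j, Real.exp (sgn (b j) * v j) := fun b => Real.exp_sum _ _
  simp_rw [h1]
  have h2 := (Finset.prod_univ_sum (fun _ : Fin n => (Finset.univ : Finset Bool))
    (fun j b => Real.exp (sgn b * v j)))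
  rw [Fintype.piFinset_univ] at h2
  rw [← h2]
  have h3 : ∀ j, ∑ b : Bool, Real.exp (sgn b * v j) ≤ 2 * Real.exp (v j ^ 2 / 2) := by
    intro j
    have := Real.cosh_le_exp_half_sq (v j)
    rw [Real.cosh_eq] at this
    simp only [Fintype.sum_bool, sgn]
    norm_num
    linarith
  calc ∏ j, ∑ b : Bool, Real.exp (sgn b * v j) ≤ ∏ j, (2 * Real.exp (v j ^ 2 / 2)) :=
        Finset.prod_le_prod (fun j _ => Finset.sum_nonneg fun _ _ => (Real.exp_pos _).le)
          (fun j _ => h3 j)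
    _ = _ := by
        rw [Finset.prod_mul_distrib, ← Real.exp_sum, Finset.sum_div]
        simp

theorem exists_signs {n : ℕ} {S : Type} [Fintype S] (v : S → Fin n → ℝ) (l : S → ℝ)
    (hl : ∀ s, 0 < l s) (hsum : ∑ s, 2 * Real.exp (-(l s) ^ 2 / 2) < 1) :
    ∃ b : Fin n → Bool, ∀ s, |∑ j, sgn (b j) * v s j| ≤ l s * √(∑ j, v s j ^ 2) := by
  classical
  set σ : S → ℝ := fun s => √(∑ j, v s j ^ 2) with hσ
  have hσ2 : ∀ s, σ s ^ 2 = ∑ j, v s j ^ 2 := fun s =>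
    Real.sq_sqrt (Finset.sum_nonneg fun _ _ => sq_nonneg _)
  have key : ∀ (r : ℝ) (s : S), r ^ 2 = 1 →
      ∑ b : Fin n → Bool, Real.exp (∑ j, sgn (b j) * (r * l s / σ s * v s j) - l s ^ 2) ≤
        2 ^ n * Real.exp (-(l s) ^ 2 / 2) := by
    intro r s hr
    simp_rw [Real.exp_sub, ← Finset.sum_div]
    rw [div_le_iff₀ (Real.exp_pos _), mul_assoc, ← Real.exp_add]
    refine (sum_signs_exp _).trans ?_
    have : (∑ j, (r * l s / σ s * v s j) ^ 2) ≤ l s ^ 2 := by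
      simp_rw [mul_pow]
      rw [← Finset.mul_sum, ← hσ2, div_pow, mul_pow, hr, one_mul]
      by_cases h : σ s = 0
      · simp [h]; positivity
      · field_simp; rfl
    gcongr
    linarith
  set Ψ : (Fin n → Bool) → ℝ := fun b => ∑ s,
    (Real.exp (∑ j, sgn (b j) * (1 * l s / σ s * v s j) - l s ^ 2) +
     Real.exp (∑ j, sgn (b j) * ((-1) * l s / σ s * v s j) - l s ^ 2)) with hΨ
  have htot : ∑ b, Ψ b < ∑ b : Fin n → Bool, (1 : ℝ) := by
    simp only [hΨ]
    rw [Finset.sum_comm]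
    calc _ ≤ ∑ s, 2 ^ n * (2 * Real.exp (-(l s) ^ 2 / 2)) := by
          apply Finset.sum_le_sum
          intro s _
          rw [Finset.sum_add_distrib]
          have h1 := key 1 s (by norm_num)
          have h2 := key (-1) s (by norm_num)
          linarith
      _ = 2 ^ n * ∑ s, 2 * Real.exp (-(l s) ^ 2 / 2) := by rw [Finset.mul_sum]
      _ < 2 ^ n * 1 := by gcongr
      _ = _ := by simp
  obtain ⟨b, -, hb⟩ := Finset.exists_lt_of_sum_lt htot
  refine ⟨b, fun s => ?_⟩
  have hs : Real.exp (∑ j, sgn (b j) * (1 * l s / σ s * v s j) - l s ^ 2) +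
     Real.exp (∑ j, sgn (b j) * ((-1) * l s / σ s * v s j) - l s ^ 2) < 1 := by
    refine lt_of_le_of_lt ?_ hb
    exact Finset.single_le_sum (f := fun s => Real.exp (∑ j, sgn (b j) * (1 * l s / σ s * v s j) - l s ^ 2) +
     Real.exp (∑ j, sgn (b j) * ((-1) * l s / σ s * v s j) - l s ^ 2))
      (fun _ _ => by positivity) (Finset.mem_univ s)
  have e1 := Real.exp_pos (∑ j, sgn (b j) * (1 * l s / σ s * v s j) - l s ^ 2)
  have e2 := Real.exp_pos (∑ j, sgn (b j) * ((-1) * l s / σ s * v s j) - l s ^ 2)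
  have f1 := Real.exp_lt_one_iff.1 (by linarith : Real.exp (∑ j, sgn (b j) * (1 * l s / σ s * v s j) - l s ^ 2) < 1)
  have f2 := Real.exp_lt_one_iff.1 (by linarith : Real.exp (∑ j, sgn (b j) * ((-1) * l s / σ s * v s j) - l s ^ 2) < 1)
  have g : ∀ r : ℝ, ∑ j, sgn (b j) * (r * l s / σ s * v s j) =
      (r * l s / σ s) * ∑ j, sgn (b j) * v s j := by
    intro r; rw [Finset.mul_sum]; exact Finset.sum_congr rfl fun _ _ => by ring
  rw [g] at f1 f2
  change _ ≤ l s * σ s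
  rcases (Real.sqrt_nonneg (∑ j, v s j ^ 2)).eq_or_lt with h | h
  · have h0 : σ s = 0 := h.symm
    have : ∀ j, v s j = 0 := by
      have h3 := hσ2 s
      rw [h0] at h3
      have := (Finset.sum_eq_zero_iff_of_nonneg (fun j _ => sq_nonneg (v s j))).1
        (by rw [← h3]; norm_num)
      intro j; simpa using this j (Finset.mem_univ _)
    simp [this, h0]
  · have hp : 0 < σ s := h
    have hls := hl s
    set X := ∑ j, sgn (b j) * v s j
    have f1' : l s * X < l s * (l s * σ s) := by
      have : 1 * l s / σ s * X * σ s < l s ^ 2 * σ s := by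
        apply mul_lt_mul_of_pos_right _ hp; linarith
      field_simp at this
      nlinarith
    have f2' : l s * (-X) < l s * (l s * σ s) := by
      have : (-1) * l s / σ s * X * σ s < l s ^ 2 * σ s := by
        apply mul_lt_mul_of_pos_right _ hp; linarith
      field_simp at this
      nlinarith
    rw [abs_le]
    constructor
    · linarith [lt_of_mul_lt_mul_left f2' hls.le]
    · exact (lt_of_mul_lt_mul_left f1' hls.le).le

def ev {ι Ω : Type} [Fintype ι] (e : ι → Ω → ℂ) (c : ι → ℂ) (x : Ω) : ℂ := ∑ k, c k * e k x

def nrm2 {ι : Type} [Fintype ι] (c : ι → ℂ) : ℝ := ∑ k, ‖c k‖ ^ 2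

def av {κ : Type} [Fintype κ] (g : κ → ℝ) : ℝ := (∑ i, g i) / (Fintype.card κ)

section basic
variable {ι Ω : Type} [Fintype ι]

theorem ev_sub (e : ι → Ω → ℂ) (c c' : ι → ℂ) (x : Ω) : ev e (c - c') x = ev e c x - ev e c' x := by
  simp [ev, sub_mul, Finset.sum_sub_distrib]

theorem ev_zero (e : ι → Ω → ℂ) (x : Ω) : ev e 0 x = 0 := by simp [ev]

theorem ev_smul (e : ι → Ω → ℂ) (r : ℂ) (c : ι → ℂ) (x : Ω) : ev e (r • c) x = r * ev e c x := by
  simp [ev, Finset.mul_sum, mul_assoc]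

theorem nrm2_nonneg (c : ι → ℂ) : 0 ≤ nrm2 c := Finset.sum_nonneg fun _ _ => by positivity

theorem ev_sq_le (e : ι → Ω → ℂ) (he : ∀ k x, ‖e k x‖ ≤ 1) (c : ι → ℂ) (x : Ω) :
    ‖ev e c x‖ ^ 2 ≤ Fintype.card ι * nrm2 c := by
  have h1 : ‖ev e c x‖ ≤ ∑ k, ‖c k‖ := by
    refine (norm_sum_le _ _).trans (Finset.sum_le_sum fun k _ => ?_)
    rw [norm_mul]
    exact mul_le_of_le_one_right (norm_nonneg _) (he k x)
  calc ‖ev e c x‖ ^ 2 ≤ (∑ k, ‖c k‖) ^ 2 := by gcongr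
    _ ≤ _ := by
      have := sq_sum_le_card_mul_sum_sq (s := (Finset.univ : Finset ι)) (f := fun k => ‖c k‖)
      simpa [nrm2] using this

/-- one perceptron step -/
theorem percep_step (e : ι → Ω → ℂ) (he : ∀ k x, ‖e k x‖ ≤ 1) (hN : 0 < Fintype.card ι)
    (c : ι → ℂ) (x : Ω) (t : ℝ) (ht : 0 < t) (hx : t < ‖ev e c x‖) :
    ∃ σ : Fin 4, nrm2 (c - fun k => ((t / (2 * Fintype.card ι) : ℝ) : ℂ) * Complex.I ^ (σ : ℕ) *
      (starRingEnd ℂ) (e k x)) ≤ nrm2 c - t ^ 2 / (4 * Fintype.card ι) := by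
  have hN' : (0 : ℝ) < Fintype.card ι := by exact_mod_cast hN
  set N : ℝ := ((Fintype.card ι : ℕ) : ℝ)
  set η : ℝ := t / (2 * N) with hη
  have hηp : 0 < η := by positivity
  -- general expansion
  have key : ∀ u : ℂ, ‖u‖ = 1 → t / 2 ≤ ((starRingEnd ℂ) u * ev e c x).re →
      nrm2 (c - fun k => (η : ℂ) * u * (starRingEnd ℂ) (e k x)) ≤ nrm2 c - t ^ 2 / (4 * N) := by
    intro u hu hre
    have h1 : ∀ k, ‖c k - (η : ℂ) * u * (starRingEnd ℂ) (e k x)‖ ^ 2 ≤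
        ‖c k‖ ^ 2 - 2 * η * ((starRingEnd ℂ) u * (c k * e k x)).re + η ^ 2 := by
      intro k
      have hk : ‖(η : ℂ) * u * (starRingEnd ℂ) (e k x)‖ ^ 2 ≤ η ^ 2 := by
        rw [norm_mul, norm_mul, hu, RCLike.norm_conj, Complex.norm_real, Real.norm_eq_abs,
          abs_of_pos hηp, mul_one]
        have := he k x
        have h0 := norm_nonneg (e k x)
        rw [mul_pow]
        have : ‖e k x‖ ^ 2 ≤ 1 := by nlinarith
        nlinarith [sq_nonneg η]
      have h2 : ‖c k - (η : ℂ) * u * (starRingEnd ℂ) (e k x)‖ ^ 2 =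
        ‖c k‖ ^ 2 - 2 * η * ((starRingEnd ℂ) u * (c k * e k x)).re +
          ‖(η : ℂ) * u * (starRingEnd ℂ) (e k x)‖ ^ 2 := by
        simp only [← Complex.normSq_eq_norm_sq, Complex.normSq_apply]
        simp
        ring
      rw [h2]; linarith
    have h3 : nrm2 (c - fun k => (η : ℂ) * u * (starRingEnd ℂ) (e k x)) ≤
        nrm2 c - 2 * η * ((starRingEnd ℂ) u * ev e c x).re + N * η ^ 2 := by
      calc _ ≤ ∑ k, (‖c k‖ ^ 2 - 2 * η * ((starRingEnd ℂ) u * (c k * e k x)).re + η ^ 2) :=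
            Finset.sum_le_sum fun k _ => h1 k
        _ = _ := by
          rw [Finset.sum_add_distrib, Finset.sum_sub_distrib, ← Finset.mul_sum, ← Complex.re_sum,
            ← Finset.mul_sum]
          simp [nrm2, ev, N]
    refine h3.trans ?_
    have h4 : N * η ^ 2 = t ^ 2 / (4 * N) := by rw [hη]; field_simp; norm_num
    have h5 : 2 * η * (t / 2) = 2 * (t ^ 2 / (4 * N)) := by rw [hη]; field_simp; norm_num
    nlinarith
  have hre := Complex.norm_le_abs_re_add_abs_im (ev e c x)
  set z := ev e c x
  by_cases h : t / 2 ≤ |z.re|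
  · rcases le_abs.1 h with h | h
    · exact ⟨0, key (Complex.I ^ 0) (by simp) (by simpa using h)⟩
    · exact ⟨2, key (Complex.I ^ 2) (by simp) (by simpa using h)⟩
  · have h' : t / 2 ≤ |z.im| := by linarith
    rcases le_abs.1 h' with h | h
    · exact ⟨1, key (Complex.I ^ 1) (by simp) (by simpa using h)⟩
    · exact ⟨3, key (Complex.I ^ 3) (by simp) (by simpa [Complex.I_pow_three] using h)⟩

theorem percep {κ : Type} [Fintype κ] (e : ι → κ → ℂ) (he : ∀ k x, ‖e k x‖ ≤ 1)
    (hN : 0 < Fintype.card ι) (t : ℝ) (ht : 0 < t) (s : ℕ) :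
    ∃ H : Finset (ι → ℂ), H.card ≤ (4 * Fintype.card κ + 1) ^ s ∧
      ∀ c, nrm2 c ≤ s * (t ^ 2 / (4 * Fintype.card ι)) → ∃ h ∈ H, ∀ x, ‖ev e (c - h) x‖ ≤ t := by
  classical
  induction s with
  | zero =>
    refine ⟨{0}, by simp, fun c hc => ⟨0, by simp, fun x => ?_⟩⟩
    have h1 := ev_sq_le e he c x
    have h2 : nrm2 c = 0 := le_antisymm (by simpa using hc) (nrm2_nonneg c)
    rw [h2, mul_zero] at h1
    rw [sub_zero]
    nlinarith [norm_nonneg (ev e c x)]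
  | succ s ih =>
    obtain ⟨H, hH, hcov⟩ := ih
    set g : κ × Fin 4 → (ι → ℂ) := fun p k =>
      ((t / (2 * Fintype.card ι) : ℝ) : ℂ) * Complex.I ^ (p.2 : ℕ) * (starRingEnd ℂ) (e k p.1)
    refine ⟨insert 0 ((Finset.univ ×ˢ H).image fun p : (κ × Fin 4) × (ι → ℂ) => p.2 + g p.1), ?_, ?_⟩
    · refine (Finset.card_insert_le _ _).trans ?_
      refine (Nat.add_le_add_right Finset.card_image_le 1).trans ?_
      rw [Finset.card_product]
      simp only [Finset.card_univ, Fintype.card_prod, Fintype.card_fin]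
      have h1 : 1 ≤ (4 * Fintype.card κ + 1) ^ s := Nat.one_le_pow _ _ (by omega)
      rw [pow_succ]
      nlinarith
    · intro c hc
      by_cases hx : ∀ x, ‖ev e c x‖ ≤ t
      · exact ⟨0, by simp, by simpa using hx⟩
      · push Not at hx
        obtain ⟨x, hx⟩ := hx
        obtain ⟨σ, hσ⟩ := percep_step e he hN c x t ht hx
        obtain ⟨h, hh, hle⟩ := hcov (c - g (x, σ)) (by
          refine hσ.trans ?_
          push_cast at hc
          linarith)
        refine ⟨h + g (x, σ), ?_, fun y => ?_⟩
        · apply Finset.mem_insert_of_mem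
          exact Finset.mem_image.2 ⟨((x, σ), h), by simp [hh], rfl⟩
        · have := hle y
          rwa [sub_sub, add_comm] at this
end basic

end Part1
section Part2

section nets
variable {ι κ : Type} [Fintype ι] [Fintype κ]

theorem av_mono {g h : κ → ℝ} (H : ∀ i, g i ≤ h i) : av g ≤ av h := by
  unfold av; gcongr; exact H _

theorem av_mul (a : ℝ) (g : κ → ℝ) : av (fun i => a * g i) = a * av g := by
  unfold av; rw [← Finset.mul_sum, mul_div_assoc]

theorem av_add (g h : κ → ℝ) : av (fun i => g i + h i) = av g + av h := by
  unfold av; rw [Finset.sum_add_distrib, add_div]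

theorem av_nonneg {g : κ → ℝ} (H : ∀ i, 0 ≤ g i) : 0 ≤ av g :=
  div_nonneg (Finset.sum_nonneg fun i _ => H i) (Nat.cast_nonneg _)

theorem nrm2_le_of_sup (q : ℝ) (hq1 : 1 ≤ q) (hq2 : q < 2) (e : ι → κ → ℂ)
    (hL2 : ∀ c, nrm2 c ≤ 2 * av (fun x => ‖ev e c x‖ ^ 2)) (c : ι → ℂ) (T B : ℝ)
    (hT : ∀ x, ‖ev e c x‖ ≤ T) (hT0 : 0 ≤ T) (hB : av (fun x => ‖ev e c x‖ ^ q) ≤ B) :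
    nrm2 c ≤ 2 * (T ^ (2 - q) * B) := by
  refine (hL2 c).trans ?_
  have h1 : ∀ x, ‖ev e c x‖ ^ 2 ≤ T ^ (2 - q) * ‖ev e c x‖ ^ q := by
    intro x
    have h0 := norm_nonneg (ev e c x)
    have : ‖ev e c x‖ ^ 2 = ‖ev e c x‖ ^ (2 - q) * ‖ev e c x‖ ^ q := by
      rw [← Real.rpow_add_of_nonneg h0 (by linarith) (by linarith)]
      norm_num
    rw [this]
    gcongr
    exact hT x
  have h2 := av_mono h1
  rw [av_mul] at h2
  have : T ^ (2 - q) * av (fun x => ‖ev e c x‖ ^ q) ≤ T ^ (2 - q) * B := by gcongr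
  linarith

theorem sup_le_of_av (q : ℝ) (hq1 : 1 ≤ q) (hq2 : q < 2) (e : ι → κ → ℂ)
    (he : ∀ k x, ‖e k x‖ ≤ 1)
    (hL2 : ∀ c, nrm2 c ≤ 2 * av (fun x => ‖ev e c x‖ ^ 2)) (c : ι → ℂ)
    (hB : av (fun x => ‖ev e c x‖ ^ q) ≤ 1) (x : κ) :
    ‖ev e c x‖ ≤ (2 * Fintype.card ι : ℝ) ^ (1 / q) := by
  obtain ⟨y, -, hy⟩ := Finset.exists_max_image Finset.univ (fun x => ‖ev e c x‖) ⟨x, Finset.mem_univ _⟩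
  refine (hy x (Finset.mem_univ _)).trans ?_
  set T := ‖ev e c y‖ with hTdef
  have hT0 : 0 ≤ T := norm_nonneg _
  have h1 := nrm2_le_of_sup q hq1 hq2 e hL2 c T 1 (fun x => hy x (Finset.mem_univ _)) hT0 hB
  have h2 := ev_sq_le e he c y
  rw [← hTdef] at h2
  rcases hT0.eq_or_lt with h | h
  · rw [← h]; positivity
  have h3 : T ^ (2 : ℕ) = T ^ (2 - q) * T ^ q := by
    rw [← Real.rpow_add h]; norm_num
  have h4 : 0 < T ^ (2 - q) := by positivity
  have h5 : T ^ (2 - q) * T ^ q ≤ T ^ (2 - q) * (2 * Fintype.card ι) := by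
    rw [← h3]
    have : (Fintype.card ι : ℝ) * nrm2 c ≤ Fintype.card ι * (2 * (T ^ (2 - q) * 1)) := by gcongr
    nlinarith
  have h6 := le_of_mul_le_mul_left h5 h4
  rw [one_div]
  exact (Real.le_rpow_inv_iff_of_pos hT0 (by positivity) (by linarith)).2 h6

theorem norm_sub_rpow_le (q : ℝ) (hq1 : 1 ≤ q) (hq2 : q < 2) (a b : ℂ) :
    ‖a - b‖ ^ q ≤ 2 * ‖a‖ ^ q + 2 * ‖b‖ ^ q := by
  have h1 : (‖a‖ + ‖b‖) ^ q ≤ 2 ^ (q - 1) * (‖a‖ ^ q + ‖b‖ ^ q) := by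
    have := NNReal.rpow_add_le_mul_rpow_add_rpow ‖a‖₊ ‖b‖₊ hq1
    exact_mod_cast this
  have h2 : ‖a - b‖ ^ q ≤ (‖a‖ + ‖b‖) ^ q :=
    Real.rpow_le_rpow (norm_nonneg _) (norm_sub_le _ _) (by linarith)
  have h3 : (2 : ℝ) ^ (q - 1) ≤ 2 := by
    calc (2 : ℝ) ^ (q - 1) ≤ 2 ^ (1 : ℝ) :=
          Real.rpow_le_rpow_of_exponent_le (by norm_num) (by linarith)
      _ = 2 := by norm_num
  have : 0 ≤ ‖a‖ ^ q + ‖b‖ ^ q := by positivity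
  nlinarith

/-- the scale at level `k` -/
def tk (N : ℕ) (q : ℝ) (k : ℕ) : ℝ := (2 * N : ℝ) ^ (1 / q) / 2 ^ k

theorem tk_pos {N : ℕ} (hN : 0 < N) (q : ℝ) (k : ℕ) : 0 < tk N q k := by
  unfold tk; positivity

theorem tk_rpow {N : ℕ} (q : ℝ) (hq1 : 1 ≤ q) (k : ℕ) :
    tk N q k ^ q * ((2 : ℝ) ^ k) ^ q = 2 * N := by
  unfold tk
  rw [Real.div_rpow (by positivity) (by positivity), ← Real.rpow_mul (by positivity),
    one_div_mul_cancel (by linarith), Real.rpow_one]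
  have : (0 : ℝ) < ((2 : ℝ) ^ k) ^ q := by positivity
  field_simp

theorem nets (q : ℝ) (hq1 : 1 ≤ q) (hq2 : q < 2) (e : ι → κ → ℂ)
    (he : ∀ k x, ‖e k x‖ ≤ 1) (hN : 0 < Fintype.card ι)
    (hL2 : ∀ c, nrm2 c ≤ 2 * av (fun x => ‖ev e c x‖ ^ 2)) (k : ℕ) :
    ∃ T : Finset (ι → ℂ), (∀ p ∈ T, av (fun x => ‖ev e p x‖ ^ q) ≤ 1) ∧
      (T.card : ℝ) ≤ Real.exp (257 * Real.log (4 * Fintype.card κ + 1) * ((2 : ℝ) ^ k) ^ q) ∧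
      ∀ c, av (fun x => ‖ev e c x‖ ^ q) ≤ 1 →
        ∃ p ∈ T, ∀ x, ‖ev e (c - p) x‖ ≤ tk (Fintype.card ι) q k := by
  classical
  have hlog : 0 ≤ Real.log (4 * Fintype.card κ + 1) :=
    Real.log_nonneg (by have : (0 : ℝ) ≤ Fintype.card κ := Nat.cast_nonneg _
                        linarith)
  have h0F : av (fun x => ‖ev e (0 : ι → ℂ) x‖ ^ q) ≤ 1 := by
    simp [ev_zero, av, Real.zero_rpow (by linarith : q ≠ 0)]
  have hNr : (0 : ℝ) < Fintype.card ι := by exact_mod_cast hN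
  induction k with
  | zero =>
    refine ⟨{0}, by simpa using h0F, ?_, fun c hc => ⟨0, by simp, fun x => ?_⟩⟩
    · simp; positivity
    · rw [sub_zero]
      simpa [tk] using sup_le_of_av q hq1 hq2 e he hL2 c hc x
  | succ k ih =>
    obtain ⟨T, hTF, hTc, hT⟩ := ih
    set t := tk (Fintype.card ι) q k with ht
    have htp : 0 < t := tk_pos hN q k
    set D : ℝ := ((2 : ℝ) ^ k) ^ q with hD
    have hD1 : 1 ≤ D := Real.one_le_rpow (one_le_pow₀ (by norm_num)) (by linarith)
    have htD : t ^ q * D = 2 * Fintype.card ι := tk_rpow q hq1 k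
    set s : ℕ := ⌈256 * D⌉₊ with hs
    have hs1 : 256 * D ≤ s := Nat.le_ceil _
    have hs2 : (s : ℝ) ≤ 257 * D := by
      have := (Nat.ceil_lt_add_one (by positivity : 0 ≤ 256 * D)).le
      linarith
    obtain ⟨H, hHc, hH⟩ := percep e he hN (t / 4) (by positivity) s
    set R : (ι → ℂ) × (ι → ℂ) → (ι → ℂ) → Prop := fun ph c =>
      av (fun x => ‖ev e c x‖ ^ q) ≤ 1 ∧ ∀ x, ‖ev e (c - ph.1 - ph.2) x‖ ≤ t / 4 with hR
    set rep : (ι → ℂ) × (ι → ℂ) → (ι → ℂ) := fun ph =>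
      if h : ∃ c, R ph c then h.choose else 0 with hrep
    refine ⟨(T ×ˢ H).image rep, ?_, ?_, ?_⟩
    · intro p hp
      obtain ⟨ph, -, rfl⟩ := Finset.mem_image.1 hp
      by_cases h : ∃ c, R ph c
      · simp only [hrep, dif_pos h]; exact h.choose_spec.1
      · simp only [hrep, dif_neg h]; exact h0F
    · have h1 : (((T ×ˢ H).image rep).card : ℝ) ≤ T.card * H.card := by
        rw [← Nat.cast_mul, ← Finset.card_product]
        exact_mod_cast Finset.card_image_le
      have h2 : (H.card : ℝ) ≤ Real.exp (257 * Real.log (4 * Fintype.card κ + 1) * D) := by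
        calc (H.card : ℝ) ≤ (4 * Fintype.card κ + 1 : ℝ) ^ s := by exact_mod_cast hHc
          _ = Real.exp (Real.log (4 * Fintype.card κ + 1) * s) := by
            rw [← Real.rpow_natCast, Real.rpow_def_of_pos (by positivity)]
          _ ≤ _ := by
            apply Real.exp_le_exp.2
            nlinarith
      refine h1.trans ?_
      calc (T.card : ℝ) * H.card ≤ Real.exp (257 * Real.log (4 * Fintype.card κ + 1) * D) *
            Real.exp (257 * Real.log (4 * Fintype.card κ + 1) * D) := by gcongr
        _ = Real.exp (257 * Real.log (4 * Fintype.card κ + 1) * (D * 2)) := by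
            rw [← Real.exp_add]; ring_nf
        _ ≤ _ := by
            have h3 : D * 2 ≤ ((2 : ℝ) ^ (k + 1)) ^ q := by
              rw [pow_succ, Real.mul_rpow (by positivity) (by norm_num)]
              have : (2 : ℝ) ≤ 2 ^ q := by
                calc (2 : ℝ) = 2 ^ (1 : ℝ) := by norm_num
                  _ ≤ _ := Real.rpow_le_rpow_of_exponent_le (by norm_num) hq1
              gcongr
            gcongr
    · intro c hc
      obtain ⟨p, hp, hpc⟩ := hT c hc
      have hav : av (fun x => ‖ev e (c - p) x‖ ^ q) ≤ 4 := by
        have h1 : av (fun x => ‖ev e (c - p) x‖ ^ q) ≤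
            av (fun x => 2 * ‖ev e c x‖ ^ q + 2 * ‖ev e p x‖ ^ q) := by
          apply av_mono; intro x; rw [ev_sub]; exact norm_sub_rpow_le q hq1 hq2 _ _
        rw [av_add, av_mul, av_mul] at h1
        linarith [hTF p hp]
      have hn := nrm2_le_of_sup q hq1 hq2 e hL2 (c - p) t 4 hpc htp.le hav
      obtain ⟨h, hh, hle⟩ := hH (c - p) (by
        refine hn.trans ?_
        have e1 : t ^ 2 = t ^ (2 - q) * t ^ q := by
          rw [← Real.rpow_add htp]; norm_num
        have e2 : (256 * D) * ((t / 4) ^ 2 / (4 * Fintype.card ι)) = 8 * t ^ (2 - q) := by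
          rw [div_pow, e1]
          field_simp
          linear_combination 256 * htD
        calc 2 * (t ^ (2 - q) * 4) = 8 * t ^ (2 - q) := by ring
          _ = (256 * D) * ((t / 4) ^ 2 / (4 * Fintype.card ι)) := e2.symm
          _ ≤ _ := by gcongr)
      have hex : ∃ c, R (p, h) c := ⟨c, hc, hle⟩
      refine ⟨rep (p, h), Finset.mem_image.2 ⟨(p, h), by simp [hp, hh], rfl⟩, fun x => ?_⟩
      have h1 : ‖ev e (rep (p, h) - p - h) x‖ ≤ t / 4 := by
        simp only [hrep, dif_pos hex]; exact hex.choose_spec.2 x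
      have h2 := hle x
      have h3 : c - rep (p, h) = (c - p - h) - (rep (p, h) - p - h) := by abel
      rw [h3, ev_sub]
      refine (norm_sub_le _ _).trans ?_
      have : tk (Fintype.card ι) q (k + 1) = t / 2 := by
        rw [ht, tk, tk, pow_succ]; field_simp
      linarith
end nets

end Part2
section Part3

theorem rpow_diff_aux (q : ℝ) (hq1 : 1 ≤ q) (hq2 : q < 2) (a b : ℝ) (hb : 0 ≤ b)
    (hab : b ≤ a) : a ^ q - b ^ q ≤ 2 * a ^ (q - 1) * (a - b) := by
  rcases (hb.trans hab).eq_or_lt with h | h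
  · have : b = 0 := by linarith
    subst this; rw [← h]; simp
  have h1 := one_add_mul_self_le_rpow_one_add (s := b / a - 1) (by
    have : 0 ≤ b / a := by positivity
    linarith) hq1
  have h2 : 1 + (b / a - 1) = b / a := by ring
  rw [h2, Real.div_rpow hb h.le] at h1
  have h3 : a ^ q = a ^ (q - 1) * a := by
    rw [← Real.rpow_add_one h.ne']; norm_num
  have h4 : 0 < a ^ q := by positivity
  have h6 : a ^ q * (1 + q * (b / a - 1)) ≤ b ^ q := by
    rw [le_div_iff₀ h4] at h1; linarith
  have h7 : a ^ q * (1 + q * (b / a - 1)) = a ^ q - q * a ^ (q - 1) * (a - b) := by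
    rw [h3]; field_simp; ring
  have h8 : 0 ≤ a ^ (q - 1) * (a - b) := mul_nonneg (by positivity) (by linarith)
  nlinarith

theorem rpow_diff (q : ℝ) (hq1 : 1 ≤ q) (hq2 : q < 2) (a b W : ℝ) (ha : 0 ≤ a) (hb : 0 ≤ b)
    (haW : a ≤ W) (hbW : b ≤ W) : |a ^ q - b ^ q| ≤ 2 * W ^ (q - 1) * |a - b| := by
  rcases le_total b a with h | h
  · have h1 := rpow_diff_aux q hq1 hq2 a b hb h
    have h2 : b ^ q ≤ a ^ q := Real.rpow_le_rpow hb h (by linarith)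
    rw [abs_of_nonneg (by linarith), abs_of_nonneg (by linarith)]
    refine h1.trans ?_
    have : a ^ (q - 1) ≤ W ^ (q - 1) := Real.rpow_le_rpow ha haW (by linarith)
    have h3 : 0 ≤ a - b := by linarith
    gcongr
  · have h1 := rpow_diff_aux q hq1 hq2 b a ha h
    have h2 : a ^ q ≤ b ^ q := Real.rpow_le_rpow ha h (by linarith)
    rw [abs_of_nonpos (by linarith), abs_of_nonpos (by linarith)]
    have : b ^ (q - 1) ≤ W ^ (q - 1) := Real.rpow_le_rpow hb hbW (by linarith)
    have h3 : 0 ≤ b - a := by linarith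
    have : 2 * b ^ (q - 1) * (b - a) ≤ 2 * W ^ (q - 1) * (b - a) := by gcongr
    linarith

def uu (q s p : ℝ) : ℝ := max p s ^ q - s ^ q

theorem uu_zero (q s p : ℝ) (h : p ≤ s) : uu q s p = 0 := by simp [uu, max_eq_right h]

theorem const_rpow_le (q : ℝ) (hq1 : 1 ≤ q) (hq2 : q < 2) (K φ : ℝ) (hK : 1 ≤ K) (hφ : 0 ≤ φ) :
    (K * φ) ^ (q - 1) ≤ K * φ ^ (q - 1) := by
  rw [Real.mul_rpow (by linarith) hφ]
  gcongr
  calc K ^ (q - 1) ≤ K ^ (1 : ℝ) := Real.rpow_le_rpow_of_exponent_le hK (by linarith)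
    _ = K := by simp

theorem incr_bound (q : ℝ) (hq1 : 1 ≤ q) (hq2 : q < 2) (φ p p' t : ℝ) (hφ : 0 ≤ φ)
    (ht : 0 < t) (h1 : |p - φ| ≤ t / 2) (h2 : |p' - φ| ≤ t) :
    |uu q t p - uu q (2 * t) p'| ≤ if t / 2 < φ then 20 * t * φ ^ (q - 1) else 0 := by
  obtain ⟨h1a, h1b⟩ := abs_le.1 h1
  obtain ⟨h2a, h2b⟩ := abs_le.1 h2
  split_ifs with h
  · have hm1 : max p t ≤ 4 * φ := max_le (by linarith) (by linarith)
    have hm2 : max p' (2 * t) ≤ 4 * φ := max_le (by linarith) (by linarith)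
    have d1 := rpow_diff q hq1 hq2 (max p t) (max p' (2 * t)) (4 * φ)
      (le_max_of_le_right ht.le) (le_max_of_le_right (by linarith)) hm1 hm2
    have d2 := rpow_diff q hq1 hq2 (2 * t) t (4 * φ) (by linarith) ht.le (by linarith) (by linarith)
    have d3 : |max p t - max p' (2 * t)| ≤ 3 / 2 * t := by
      refine (abs_max_sub_max_le_max _ _ _ _).trans (max_le ?_ ?_)
      · rw [abs_le]; constructor <;> linarith
      · rw [abs_le]; constructor <;> linarith
    have d4 : |2 * t - t| = t := by rw [abs_of_pos] <;> linarith
    rw [d4] at d2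
    have d5 := const_rpow_le q hq1 hq2 4 φ (by norm_num) hφ
    have d6 : 0 ≤ (4 * φ) ^ (q - 1) := by positivity
    have e1 : |max p t ^ q - max p' (2 * t) ^ q| ≤ 12 * t * φ ^ (q - 1) := by
      refine d1.trans ?_
      calc 2 * (4 * φ) ^ (q - 1) * |max p t - max p' (2 * t)| ≤
            2 * (4 * φ ^ (q - 1)) * (3 / 2 * t) := by gcongr
        _ = _ := by ring
    have e2 : |(2 * t) ^ q - t ^ q| ≤ 8 * t * φ ^ (q - 1) := by
      refine d2.trans ?_
      calc 2 * (4 * φ) ^ (q - 1) * t ≤ 2 * (4 * φ ^ (q - 1)) * t := by gcongr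
        _ = _ := by ring
    have e3 : uu q t p - uu q (2 * t) p' =
      (max p t ^ q - max p' (2 * t) ^ q) + ((2 * t) ^ q - t ^ q) := by unfold uu; ring
    rw [e3]
    refine (abs_add_le _ _).trans ?_
    linarith
  · rw [uu_zero _ _ _ (by linarith), uu_zero _ _ _ (by linarith)]; simp

theorem bottom_bound (q : ℝ) (hq1 : 1 ≤ q) (hq2 : q < 2) (φ p t : ℝ) (hφ : 0 ≤ φ)
    (ht : 0 < t) (ht1 : t ≤ 1) (h1 : |p - φ| ≤ t) :
    |φ ^ q - uu q (2 * t) p| ≤ 8 * t * (1 + φ ^ q) := by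
  obtain ⟨h1a, h1b⟩ := abs_le.1 h1
  have hφq : 0 ≤ φ ^ q := by positivity
  rcases le_or_gt φ t with h | h
  · rw [uu_zero _ _ _ (by linarith), sub_zero, abs_of_nonneg hφq]
    have : φ ^ q ≤ t := by
      calc φ ^ q ≤ t ^ q := Real.rpow_le_rpow hφ h (by linarith)
        _ ≤ t ^ (1 : ℝ) := Real.rpow_le_rpow_of_exponent_ge ht ht1 hq1
        _ = t := by simp
    nlinarith [mul_nonneg ht.le hφq]
  · have d1 := rpow_diff q hq1 hq2 φ (max p (2 * t)) (2 * φ) hφ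
      (le_max_of_le_right (by linarith)) (by linarith) (max_le (by linarith) (by linarith))
    have d3 : |φ - max p (2 * t)| ≤ t := by
      rcases le_total p (2 * t) with h' | h'
      · rw [max_eq_right h', abs_le]; constructor <;> linarith
      · rw [max_eq_left h', abs_le]; constructor <;> linarith
    have d5 := const_rpow_le q hq1 hq2 2 φ (by norm_num) hφ
    have d6 : 0 ≤ (2 * φ) ^ (q - 1) := by positivity
    have e1 : |φ ^ q - max p (2 * t) ^ q| ≤ 4 * t * φ ^ (q - 1) := by
      refine d1.trans ?_
      calc 2 * (2 * φ) ^ (q - 1) * |φ - max p (2 * t)| ≤ 2 * (2 * φ ^ (q - 1)) * t := by gcongr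
        _ = _ := by ring
    have e2 : (2 * t) ^ q ≤ 4 * t * φ ^ (q - 1) := by
      calc (2 * t) ^ q = (2 * t) ^ (q - 1) * (2 * t) := by
            rw [← Real.rpow_add_one (by positivity)]; norm_num
        _ ≤ (2 * φ) ^ (q - 1) * (2 * t) := by
            have : (2 * t) ^ (q - 1) ≤ (2 * φ) ^ (q - 1) :=
              Real.rpow_le_rpow (by positivity) (by linarith) (by linarith)
            gcongr
        _ ≤ (2 * φ ^ (q - 1)) * (2 * t) := by gcongr
        _ = _ := by ring
    have e3 : φ ^ q - uu q (2 * t) p = (φ ^ q - max p (2 * t) ^ q) + (2 * t) ^ q := by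
      unfold uu; ring
    rw [e3]
    refine (abs_add_le _ _).trans ?_
    rw [abs_of_nonneg (by positivity : 0 ≤ (2 * t) ^ q)]
    have e4 : φ ^ (q - 1) ≤ 1 + φ ^ q := by
      rcases le_total φ 1 with h' | h'
      · have : φ ^ (q - 1) ≤ 1 := Real.rpow_le_one hφ h' (by linarith)
        linarith
      · have : φ ^ (q - 1) ≤ φ ^ q := Real.rpow_le_rpow_of_exponent_le h' (by linarith)
        linarith
    have : 8 * t * φ ^ (q - 1) ≤ 8 * t * (1 + φ ^ q) := by gcongr
    linarith

theorem geom_bound (a : ℝ) (ha : 0 < a) (φ : ℝ) (hφ : 0 < φ) (L : ℕ) :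
    ∀ t0 : ℝ, 0 < t0 →
    ∑ k ∈ Finset.range L, (if t0 / 2 ^ k / 2 < φ then (t0 / 2 ^ k) ^ a else 0) ≤
      (min t0 (2 * φ)) ^ a / (1 - (1 / 2) ^ a) := by
  have hr : (1 / 2 : ℝ) ^ a < 1 := Real.rpow_lt_one (by norm_num) (by norm_num) ha
  have hr' : 0 < 1 - (1 / 2 : ℝ) ^ a := by linarith
  induction L with
  | zero =>
    intro t0 h
    rw [Finset.sum_range_zero]
    exact div_nonneg (Real.rpow_nonneg (le_min h.le (by positivity)) _) hr'.le
  | succ L ih =>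
    intro t0 h
    rw [Finset.sum_range_succ']
    have h1 := ih (t0 / 2) (by positivity)
    have h2 : ∀ k : ℕ, t0 / 2 ^ (k + 1) = t0 / 2 / 2 ^ k := by
      intro k; rw [pow_succ]; field_simp
    simp_rw [h2]
    simp only [pow_zero, div_one]
    split_ifs with h3
    · have h4 : min t0 (2 * φ) = t0 := min_eq_left (by linarith)
      have h5 : min (t0 / 2) (2 * φ) = t0 * (1 / 2) := by rw [min_eq_left (by linarith)]; ring
      rw [h5, Real.mul_rpow h.le (by norm_num)] at h1
      rw [h4]
      have : t0 ^ a / (1 - (1 / 2) ^ a) = t0 ^ a * (1 / 2) ^ a / (1 - (1 / 2) ^ a) + t0 ^ a := by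
        field_simp; ring
      rw [this]; linarith
    · rw [add_zero]
      refine h1.trans ?_
      gcongr
      linarith

theorem geom_bound' (q : ℝ) (hq1 : 1 ≤ q) (hq2 : q < 2) (φ : ℝ) (hφ : 0 ≤ φ) (L : ℕ)
    (t0 : ℝ) (ht0 : 0 < t0) :
    ∑ k ∈ Finset.range L,
      (if t0 / 2 ^ k / 2 < φ then (t0 / 2 ^ k) ^ (2 - q) * (φ ^ (q - 1)) ^ 2 else 0) ≤
      2 / (1 - (1 / 2) ^ (2 - q)) * φ ^ q := by
  have hr : (1 / 2 : ℝ) ^ (2 - q) < 1 := Real.rpow_lt_one (by norm_num) (by norm_num) (by linarith)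
  have hr' : 0 < 1 - (1 / 2 : ℝ) ^ (2 - q) := by linarith
  rcases hφ.eq_or_lt with h | h
  · rw [← h]
    have : ∀ k : ℕ, ¬ (t0 / 2 ^ k / 2 < 0) := fun k => not_lt.2 (by positivity)
    have hz : ∑ k ∈ Finset.range L, (if t0 / 2 ^ k / 2 < (0 : ℝ) then
        (t0 / 2 ^ k) ^ (2 - q) * ((0 : ℝ) ^ (q - 1)) ^ 2 else 0) = 0 := by
      apply Finset.sum_eq_zero; intro k _; rw [if_neg (this k)]
    rw [hz]
    exact mul_nonneg (div_nonneg (by norm_num) hr'.le) (Real.rpow_nonneg le_rfl _)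
  have h1 := geom_bound (2 - q) (by linarith) φ h L t0 ht0
  have h2 : ∀ k : ℕ, (if t0 / 2 ^ k / 2 < φ then (t0 / 2 ^ k) ^ (2 - q) * (φ ^ (q - 1)) ^ 2 else 0)
      = (if t0 / 2 ^ k / 2 < φ then (t0 / 2 ^ k) ^ (2 - q) else 0) * (φ ^ (q - 1)) ^ 2 := by
    intro k; split_ifs <;> simp
  simp_rw [h2]
  rw [← Finset.sum_mul]
  have h3 : (min t0 (2 * φ)) ^ (2 - q) ≤ 2 * φ ^ (2 - q) := by
    calc (min t0 (2 * φ)) ^ (2 - q) ≤ (2 * φ) ^ (2 - q) :=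
          Real.rpow_le_rpow (le_min ht0.le (by positivity)) (min_le_right _ _) (by linarith)
      _ = 2 ^ (2 - q) * φ ^ (2 - q) := Real.mul_rpow (by norm_num) hφ
      _ ≤ _ := by
        gcongr
        calc (2 : ℝ) ^ (2 - q) ≤ 2 ^ (1 : ℝ) :=
              Real.rpow_le_rpow_of_exponent_le (by norm_num) (by linarith)
          _ = 2 := by norm_num
  have h4 : φ ^ (2 - q) * (φ ^ (q - 1)) ^ 2 = φ ^ q := by
    rw [← Real.rpow_natCast, ← Real.rpow_mul hφ, ← Real.rpow_add h]
    congr 1; push_cast; ring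
  calc _ ≤ (min t0 (2 * φ)) ^ (2 - q) / (1 - (1 / 2) ^ (2 - q)) * (φ ^ (q - 1)) ^ 2 := by gcongr
    _ ≤ 2 * φ ^ (2 - q) / (1 - (1 / 2) ^ (2 - q)) * (φ ^ (q - 1)) ^ 2 := by gcongr
    _ = 2 / (1 - (1 / 2) ^ (2 - q)) * (φ ^ (2 - q) * (φ ^ (q - 1)) ^ 2) := by ring
    _ = _ := by rw [h4]

end Part3
section Part4

section chain
variable {ι κ : Type} [Fintype ι] [Fintype κ]

def ZZ {n : ℕ} (b : Fin n → Bool) (a : Fin n × Bool → κ) (g : κ → ℝ) : ℝ :=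
  ∑ j, sgn (b j) * (g (a (j, true)) - g (a (j, false)))

def gk (N : ℕ) (q : ℝ) (e : ι → κ → ℂ) (k : ℕ) (p p' : ι → ℂ) (y : κ) : ℝ :=
  uu q (2 * tk N q (k + 1)) ‖ev e p y‖ - uu q (2 * tk N q k) ‖ev e p' y‖

theorem abs_sgn (b : Bool) : |sgn b| = 1 := by cases b <;> simp [sgn]

theorem ZZ_abs_le {n : ℕ} (b : Fin n → Bool) (a : Fin n × Bool → κ) (g : κ → ℝ) :
    |ZZ b a g| ≤ ∑ p, |g (a p)| := by
  unfold ZZ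
  rw [Fintype.sum_prod_type]
  refine (Finset.abs_sum_le_sum_abs _ _).trans (Finset.sum_le_sum fun j _ => ?_)
  rw [abs_mul, abs_sgn, one_mul, Fintype.sum_bool]
  exact abs_sub _ _

theorem sq_pair_le {n : ℕ} (a : Fin n × Bool → κ) (g : κ → ℝ) :
    ∑ j, (g (a (j, true)) - g (a (j, false))) ^ 2 ≤ 2 * ∑ p, g (a p) ^ 2 := by
  rw [Fintype.sum_prod_type, Finset.mul_sum]
  refine Finset.sum_le_sum fun j _ => ?_
  rw [Fintype.sum_bool]
  nlinarith [sq_nonneg (g (a (j, true)) + g (a (j, false)))]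

theorem ZZ_sub {n : ℕ} (b : Fin n → Bool) (a : Fin n × Bool → κ) (g h : κ → ℝ) :
    ZZ b a (fun y => g y - h y) = ZZ b a g - ZZ b a h := by
  unfold ZZ
  rw [← Finset.sum_sub_distrib]
  exact Finset.sum_congr rfl fun _ _ => by ring

theorem tk_succ (N : ℕ) (q : ℝ) (k : ℕ) : 2 * tk N q (k + 1) = tk N q k := by
  unfold tk; rw [pow_succ]; field_simp

theorem chain_bound (q : ℝ) (hq1 : 1 ≤ q) (hq2 : q < 2) (e : ι → κ → ℂ)
    (he : ∀ k x, ‖e k x‖ ≤ 1) (hN : 0 < Fintype.card ι)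
    (hL2 : ∀ c, nrm2 c ≤ 2 * av (fun x => ‖ev e c x‖ ^ 2))
    (n : ℕ) (a : Fin n × Bool → κ) (b : Fin n → Bool) (L : ℕ)
    (htL : tk (Fintype.card ι) q L ≤ 1) (A : ℝ) (hA : 0 ≤ A) (c : ι → ℂ)
    (hX : ∑ p, ‖ev e c (a p)‖ ^ q ≤ 8 * n)
    (π : ℕ → ι → ℂ) (hπF : av (fun x => ‖ev e (π 0) x‖ ^ q) ≤ 1)
    (hπ : ∀ k x, ‖ev e (c - π k) x‖ ≤ tk (Fintype.card ι) q k)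
    (hb : ∀ k < L, |ZZ b a (gk (Fintype.card ι) q e k (π (k + 1)) (π k))| ≤
      √(8 * A * ((2 : ℝ) ^ (k + 1)) ^ q) *
        √(∑ j, (gk (Fintype.card ι) q e k (π (k + 1)) (π k) (a (j, true)) -
          gk (Fintype.card ι) q e k (π (k + 1)) (π k) (a (j, false))) ^ 2)) :
    |ZZ b a (fun y => ‖ev e c y‖ ^ q)| ≤
      √(L * (409600 * A * Fintype.card ι * (2 / (1 - (1 / 2) ^ (2 - q))) * n)) +
        80 * n * tk (Fintype.card ι) q L := by
  set N := Fintype.card ι with hNdef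
  have hNr : (0 : ℝ) < N := by exact_mod_cast hN
  set G : ℝ := 2 / (1 - (1 / 2) ^ (2 - q)) with hG
  have hr : (1 / 2 : ℝ) ^ (2 - q) < 1 := Real.rpow_lt_one (by norm_num) (by norm_num) (by linarith)
  have hG0 : 0 ≤ G := div_nonneg (by norm_num) (by linarith)
  set W : ℕ → κ → ℝ := fun k y => uu q (2 * tk N q k) ‖ev e (π k) y‖ with hW
  have hdist : ∀ k y, |‖ev e (π k) y‖ - ‖ev e c y‖| ≤ tk N q k := by
    intro k y
    refine (abs_norm_sub_norm_le _ _).trans ?_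
    have := hπ k y
    rw [ev_sub] at this
    rwa [norm_sub_rev]
  have hW0 : W 0 = 0 := by
    funext y
    apply uu_zero
    have h1 := sup_le_of_av q hq1 hq2 e he hL2 (π 0) hπF y
    have h2 : tk N q 0 = (2 * N : ℝ) ^ (1 / q) := by simp [tk]
    have := tk_pos hN q 0
    rw [← hNdef, ← h2] at h1
    linarith
  have hgk : ∀ k, gk N q e k (π (k + 1)) (π k) = fun y => W (k + 1) y - W k y := fun k => rfl
  -- telescoping
  have htel : ZZ b a (W L) = ∑ k ∈ Finset.range L, ZZ b a (gk N q e k (π (k + 1)) (π k)) := by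
    have h1 := Finset.sum_range_sub (fun k => ZZ b a (W k)) L
    have h0 : ZZ b a (W 0) = 0 := by rw [hW0]; simp [ZZ]
    simp only [h0, sub_zero] at h1
    rw [← h1]
    exact Finset.sum_congr rfl fun k _ => by rw [hgk, ZZ_sub]
  have hsplit : ZZ b a (fun y => ‖ev e c y‖ ^ q) =
      ∑ k ∈ Finset.range L, ZZ b a (gk N q e k (π (k + 1)) (π k)) +
        ZZ b a (fun y => ‖ev e c y‖ ^ q - W L y) := by
    rw [ZZ_sub, htel]; ring
  have hbot : |ZZ b a (fun y => ‖ev e c y‖ ^ q - W L y)| ≤ 80 * n * tk N q L := by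
    have htp := tk_pos hN q L
    refine (ZZ_abs_le _ _ _).trans ?_
    calc ∑ p, |‖ev e c (a p)‖ ^ q - W L (a p)| ≤
          ∑ p : Fin n × Bool, 8 * tk N q L * (1 + ‖ev e c (a p)‖ ^ q) :=
          Finset.sum_le_sum fun p _ => bottom_bound q hq1 hq2 _ _ _ (norm_nonneg _) htp htL
            (hdist L _)
      _ = 8 * tk N q L * (2 * n + ∑ p, ‖ev e c (a p)‖ ^ q) := by
          rw [← Finset.mul_sum, Finset.sum_add_distrib]
          simp; left; ring
      _ ≤ 8 * tk N q L * (2 * n + 8 * n) := by gcongr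
      _ = _ := by ring
  have hmain : ∑ k ∈ Finset.range L, |ZZ b a (gk N q e k (π (k + 1)) (π k))| ≤
      √(L * (409600 * A * N * G * n)) := by
    apply Real.le_sqrt_of_sq_le
    refine (sq_sum_le_card_mul_sum_sq).trans ?_
    rw [Finset.card_range]
    gcongr
    have hk : ∀ k ∈ Finset.range L, |ZZ b a (gk N q e k (π (k + 1)) (π k))| ^ 2 ≤
        ∑ p, 51200 * A * N * (if tk N q 0 / 2 ^ k / 2 < ‖ev e c (a p)‖ then
          (tk N q 0 / 2 ^ k) ^ (2 - q) * (‖ev e c (a p)‖ ^ (q - 1)) ^ 2 else 0) := by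
      intro k hk
      have htk : tk N q 0 / 2 ^ k = tk N q k := by simp [tk]
      rw [htk]
      set t := tk N q k with ht
      have htp : 0 < t := tk_pos hN q k
      set D : ℝ := ((2 : ℝ) ^ k) ^ q with hD
      have hD0 : 0 ≤ D := by positivity
      have hDD : ((2 : ℝ) ^ (k + 1)) ^ q ≤ 4 * D := by
        rw [pow_succ, Real.mul_rpow (by positivity) (by norm_num), mul_comm]
        gcongr
        calc (2 : ℝ) ^ q ≤ 2 ^ (2 : ℝ) := Real.rpow_le_rpow_of_exponent_le (by norm_num) hq2.le
          _ = 4 := by norm_num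
      have hDt : D * t ^ 2 = 2 * N * t ^ (2 - q) := by
        have e1 : t ^ 2 = t ^ (2 - q) * t ^ q := by rw [← Real.rpow_add htp]; norm_num
        have e2 : t ^ q * D = 2 * N := tk_rpow q hq1 k
        rw [e1]; linear_combination t ^ (2 - q) * e2
      set g := gk N q e k (π (k + 1)) (π k) with hg
      have hgb : ∀ y, g y ^ 2 ≤ 400 * t ^ 2 * (if t / 2 < ‖ev e c y‖ then
          (‖ev e c y‖ ^ (q - 1)) ^ 2 else 0) := by
        intro y
        have h1 := incr_bound q hq1 hq2 ‖ev e c y‖ ‖ev e (π (k + 1)) y‖ ‖ev e (π k) y‖ t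
          (norm_nonneg _) htp (by
            have := hdist (k + 1) y
            have h2 := tk_succ N q k
            rw [← ht] at h2
            linarith) (hdist k y)
        have h3 : g y = uu q t ‖ev e (π (k + 1)) y‖ - uu q (2 * t) ‖ev e (π k) y‖ := by
          rw [hg, gk, tk_succ]
        rw [← h3] at h1
        rw [← sq_abs]
        split_ifs with h
        · rw [if_pos h] at h1
          calc |g y| ^ 2 ≤ (20 * t * ‖ev e c y‖ ^ (q - 1)) ^ 2 := by gcongr
            _ = _ := by ring
        · rw [if_neg h] at h1
          have : |g y| = 0 := le_antisymm h1 (abs_nonneg _)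
          rw [this]; simp
      have h1 := hb k (Finset.mem_range.1 hk)
      calc |ZZ b a g| ^ 2 ≤ (√(8 * A * ((2 : ℝ) ^ (k + 1)) ^ q) *
            √(∑ j, (g (a (j, true)) - g (a (j, false))) ^ 2)) ^ 2 := by gcongr
        _ = (8 * A * ((2 : ℝ) ^ (k + 1)) ^ q) * ∑ j, (g (a (j, true)) - g (a (j, false))) ^ 2 := by
            rw [mul_pow, Real.sq_sqrt (by positivity),
              Real.sq_sqrt (Finset.sum_nonneg fun _ _ => sq_nonneg _)]
        _ ≤ (8 * A * (4 * D)) * (2 * ∑ p, g (a p) ^ 2) := by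
            gcongr
            exact sq_pair_le a g
        _ ≤ (8 * A * (4 * D)) * (2 * ∑ p, 400 * t ^ 2 * (if t / 2 < ‖ev e c (a p)‖ then
          (‖ev e c (a p)‖ ^ (q - 1)) ^ 2 else 0)) := by
            gcongr
            exact hgb _
        _ = ∑ p, 25600 * A * (D * t ^ 2) * (if t / 2 < ‖ev e c (a p)‖ then
          (‖ev e c (a p)‖ ^ (q - 1)) ^ 2 else 0) := by
            rw [Finset.mul_sum, Finset.mul_sum]
            exact Finset.sum_congr rfl fun _ _ => by ring
        _ = _ := by
            rw [hDt]
            refine Finset.sum_congr rfl fun p _ => ?_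
            split_ifs
            · ring
            · simp
    refine (Finset.sum_le_sum hk).trans ?_
    rw [Finset.sum_comm]
    calc _ ≤ ∑ p, 51200 * A * N * (G * ‖ev e c (a p)‖ ^ q) := by
          refine Finset.sum_le_sum fun p _ => ?_
          rw [← Finset.mul_sum]
          have := geom_bound' q hq1 hq2 ‖ev e c (a p)‖ (norm_nonneg _) L (tk N q 0) (tk_pos hN q 0)
          gcongr
      _ = 51200 * A * N * G * ∑ p, ‖ev e c (a p)‖ ^ q := by
          rw [Finset.mul_sum]; exact Finset.sum_congr rfl fun _ _ => by ring
      _ ≤ 51200 * A * N * G * (8 * n) := by gcongr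
      _ = _ := by ring
  rw [hsplit]
  refine (abs_add_le _ _).trans (add_le_add ?_ hbot)
  exact (Finset.abs_sum_le_sum_abs _ _).trans hmain

end chain

end Part4
section Part5

theorem av_half {κ : Type} {n : ℕ} (b : Fin n → Bool) (a : Fin n × Bool → κ) (g : κ → ℝ) :
    av (fun j => g (a (j, b j))) - av (fun p => g (a p)) = ZZ b a g / (2 * n) := by
  unfold av ZZ
  rw [Fintype.sum_prod_type]
  simp only [Fintype.card_fin, Fintype.card_prod, Fintype.card_bool, Fintype.sum_bool]
  have h : ∀ j, g (a (j, b j)) = (g (a (j, true)) + g (a (j, false))) / 2 +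
      sgn (b j) * (g (a (j, true)) - g (a (j, false))) / 2 := by
    intro j; cases b j <;> simp [sgn] <;> ring
  simp_rw [h]
  rw [Finset.sum_add_distrib, ← Finset.sum_div, ← Finset.sum_div]
  push_cast
  ring

theorem halving (q : ℝ) (hq1 : 1 ≤ q) (hq2 : q < 2) : ∃ C : ℝ, 0 < C ∧
    ∀ (ι κ S : Type) [Fintype ι] [Fintype κ] [Fintype S] (e : ι → κ → ℂ)
      (_ : ∀ k x, ‖e k x‖ ≤ 1) (_ : 0 < Fintype.card ι) (_ : Fintype.card ι ≤ Fintype.card κ)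
      (_ : ∀ c, nrm2 c ≤ 2 * av (fun x => ‖ev e c x‖ ^ 2))
      (n : ℕ) (_ : 0 < n) (_ : n ≤ Fintype.card κ) (a : Fin n × Bool → κ)
      (_ : ∀ c, av (fun p => ‖ev e c (a p)‖ ^ q) ≤ 4 * av (fun x => ‖ev e c x‖ ^ q))
      (w : S → Fin n → ℝ) (l : S → ℝ) (_ : ∀ s, 0 < l s)
      (_ : ∑ s, 2 * Real.exp (-(l s) ^ 2 / 2) ≤ 1 / 2),
      ∃ b : Fin n → Bool,
        (∀ c, |av (fun j => ‖ev e c (a (j, b j))‖ ^ q) - av (fun p => ‖ev e c (a p)‖ ^ q)| ≤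
          C * √(Fintype.card ι / n) * Real.log (4 * Fintype.card κ + 1) *
            av (fun x => ‖ev e c x‖ ^ q)) ∧
        ∀ s, |∑ j, sgn (b j) * w s j| ≤ l s * √(∑ j, w s j ^ 2) := by
  set G : ℝ := 2 / (1 - (1 / 2) ^ (2 - q)) with hG
  have hr : (1 / 2 : ℝ) ^ (2 - q) < 1 := Real.rpow_lt_one (by norm_num) (by norm_num) (by linarith)
  have hG0 : 0 ≤ G := div_nonneg (by norm_num) (by linarith)
  refine ⟨√(4 * 102400 * 257 * G) + 40, by positivity, ?_⟩
  intro ι κ S _ _ _ e he hN hNM hL2 n hn hnM a hX w l hl hlsum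
  classical
  choose T hTF hTc hT using nets q hq1 hq2 e he hN hL2
  set N := Fintype.card ι with hNdef
  set M := Fintype.card κ with hMdef
  have hNr : (1 : ℝ) ≤ N := by exact_mod_cast hN
  have hnr : (1 : ℝ) ≤ n := by exact_mod_cast hn
  have hMN : (N : ℝ) ≤ M := by exact_mod_cast hNM
  have hMn : (n : ℝ) ≤ M := by exact_mod_cast hnM
  set Λ := Real.log (4 * M + 1) with hΛ
  have hΛ1 : 1 ≤ Λ := by
    rw [hΛ, Real.le_log_iff_exp_le (by linarith)]
    have := Real.exp_one_lt_d9
    linarith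
  set A : ℝ := 257 * Λ with hA
  have hA0 : 257 ≤ A := by linarith
  set L := Nat.clog 2 (2 * N * n) with hL
  have h2L : (2 * N * n : ℝ) ≤ 2 ^ L := by
    exact_mod_cast Nat.le_pow_clog (by norm_num) (2 * N * n)
  have hLle : (L : ℝ) ≤ 4 * Λ := by
    have h1 : 1 < 2 * N * n := by
      have : 1 ≤ N * n := Nat.mul_pos hN hn
      nlinarith
    have h2 : (2 : ℝ) ^ (L - 1) < 2 * N * n := by
      exact_mod_cast Nat.pow_pred_clog_lt_self (by norm_num) h1
    have hL1 : 1 ≤ L := Nat.clog_pos (by norm_num) (by omega)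
    have h3 : (2 : ℝ) ^ (L - 1) ≤ (4 * M + 1) ^ 2 := by nlinarith
    have h4 := Real.log_le_log (by positivity) h3
    rw [Real.log_pow, Real.log_pow, ← hΛ] at h4
    have h5 : ((L - 1 : ℕ) : ℝ) = L - 1 := by rw [Nat.cast_sub hL1]; simp
    rw [h5] at h4
    have := Real.log_two_gt_d9
    push_cast at h4
    by_contra hcon
    push Not at hcon
    nlinarith
  have htL : tk N q L ≤ 1 / n := by
    have h1 : (2 * N : ℝ) ^ (1 / q) ≤ 2 * N := by
      calc (2 * N : ℝ) ^ (1 / q) ≤ (2 * N : ℝ) ^ (1 : ℝ) := by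
            apply Real.rpow_le_rpow_of_exponent_le (by linarith)
            rw [div_le_one (by linarith)]; exact hq1
        _ = _ := by simp
    unfold tk
    rw [div_le_div_iff₀ (by positivity) (by positivity)]
    calc (2 * N : ℝ) ^ (1 / q) * n ≤ 2 * N * n := by gcongr
      _ ≤ 1 * 2 ^ L := by linarith
  have htL1 : tk N q L ≤ 1 := htL.trans (by rw [div_le_one (by linarith)]; exact hnr)
  -- the family
  let S' := S ⊕ (Σ k : Fin L, (↥(T ((k : ℕ) + 1)) × ↥(T (k : ℕ))))
  let v : S' → Fin n → ℝ := Sum.elim w (fun s j =>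
    gk N q e s.1 s.2.1 s.2.2 (a (j, true)) - gk N q e s.1 s.2.1 s.2.2 (a (j, false)))
  let l' : S' → ℝ := Sum.elim l (fun s => √(8 * A * ((2 : ℝ) ^ ((s.1 : ℕ) + 1)) ^ q))
  have hsum : ∑ s, 2 * Real.exp (-(l' s) ^ 2 / 2) < 1 := by
    rw [Fintype.sum_sum_type]
    simp only [l', Sum.elim_inl, Sum.elim_inr]
    have hk : ∀ k : ℕ, ((T (k + 1)).card : ℝ) * (T k).card *
        (2 * Real.exp (-(√(8 * A * ((2 : ℝ) ^ (k + 1)) ^ q)) ^ 2 / 2)) ≤ 1 / 8 * (1 / 2) ^ k := by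
      intro k
      set D : ℝ := ((2 : ℝ) ^ (k + 1)) ^ q with hD
      have hDk : (k : ℝ) + 2 ≤ D := by
        have h1 : (k : ℝ) + 2 ≤ 2 ^ (k + 1) := by
          have h0 : k + 1 < 2 ^ (k + 1) := Nat.lt_two_pow_self
          exact_mod_cast h0
        calc (k : ℝ) + 2 ≤ 2 ^ (k + 1) := h1
          _ = ((2 : ℝ) ^ (k + 1)) ^ (1 : ℝ) := by simp
          _ ≤ _ := Real.rpow_le_rpow_of_exponent_le (one_le_pow₀ (by norm_num)) hq1
      have hk0 : (0 : ℝ) ≤ k := Nat.cast_nonneg k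
      have hD' : ((2 : ℝ) ^ k) ^ q ≤ D := by
        apply Real.rpow_le_rpow (by positivity) _ (by linarith)
        exact pow_le_pow_right₀ (by norm_num) (by omega)
      rw [Real.sq_sqrt (by positivity)]
      calc ((T (k + 1)).card : ℝ) * (T k).card * (2 * Real.exp (-(8 * A * D) / 2)) ≤
            Real.exp (A * D) * Real.exp (A * D) * (2 * Real.exp (-(8 * A * D) / 2)) := by
            gcongr
            · exact hTc (k + 1)
            · refine (hTc k).trans (Real.exp_le_exp.2 ?_)
              gcongr
        _ = 2 * Real.exp (-(2 * (A * D))) := by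
            rw [mul_left_comm, ← Real.exp_add, ← Real.exp_add]; ring_nf
        _ ≤ 2 * Real.exp (-((k + 4 : ℕ) : ℝ)) := by
            gcongr
            push_cast
            nlinarith
        _ ≤ 2 * (1 / 2) ^ (k + 4) := by
            gcongr
            have : Real.exp (-((k + 4 : ℕ) : ℝ)) = (Real.exp (-1)) ^ (k + 4) := by
              rw [← Real.exp_nat_mul]; ring_nf
            rw [this]
            gcongr
            have := Real.exp_neg_one_lt_d9
            linarith
        _ = _ := by rw [pow_add]; ring
    have h2 : ∑ s : (Σ k : Fin L, (↥(T ((k : ℕ) + 1)) × ↥(T (k : ℕ)))),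
        2 * Real.exp (-(√(8 * A * ((2 : ℝ) ^ ((s.1 : ℕ) + 1)) ^ q)) ^ 2 / 2) ≤ 1 / 4 := by
      rw [Fintype.sum_sigma]
      simp only [Finset.sum_const, Finset.card_univ, Fintype.card_prod, Fintype.card_coe,
        nsmul_eq_mul, Nat.cast_mul]
      rw [Fin.sum_univ_eq_sum_range (fun k => ((T (k + 1)).card : ℝ) * (T k).card *
        (2 * Real.exp (-(√(8 * A * ((2 : ℝ) ^ (k + 1)) ^ q)) ^ 2 / 2)))]
      refine (Finset.sum_le_sum fun k _ => hk k).trans ?_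
      rw [← Finset.mul_sum]
      have := sum_geometric_two_le L
      linarith
    linarith
  obtain ⟨b, hb⟩ := exists_signs v l' (by
    rintro (s | s)
    · exact hl s
    · simp only [l', Sum.elim_inr]; apply Real.sqrt_pos.2; positivity) hsum
  refine ⟨b, ?_, fun s => hb (Sum.inl s)⟩
  have hn0 : (0 : ℝ) < n := by linarith
  -- normalized
  have norm1 : ∀ c, av (fun x => ‖ev e c x‖ ^ q) ≤ 1 →
      |av (fun j => ‖ev e c (a (j, b j))‖ ^ q) - av (fun p => ‖ev e c (a p)‖ ^ q)| ≤
          (√(4 * 102400 * 257 * G) + 40) * √(N / n) * Λ := by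
    intro c hc
    choose π hπT hπ using fun k => hT k c hc
    have hX8 : ∑ p, ‖ev e c (a p)‖ ^ q ≤ 8 * n := by
      have h1 := hX c
      have h2 : av (fun p => ‖ev e c (a p)‖ ^ q) ≤ 4 := by linarith
      unfold av at h2
      simp only [Fintype.card_prod, Fintype.card_fin, Fintype.card_bool] at h2
      push_cast at h2
      rw [div_le_iff₀ (by positivity)] at h2
      linarith
    have h1 := chain_bound q hq1 hq2 e he hN hL2 n a b L htL1 A (by linarith) c hX8 π
      (hTF 0 _ (hπT 0)) hπ (fun k hk =>
        hb (Sum.inr ⟨⟨k, hk⟩, (⟨π (k + 1), hπT (k + 1)⟩, ⟨π k, hπT k⟩)⟩))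
    rw [av_half b a (fun y => ‖ev e c y‖ ^ q), abs_div, abs_of_pos (by positivity : (0 : ℝ) < 2 * n),
      div_le_iff₀ (by positivity)]
    refine h1.trans ?_
    rw [← hNdef, ← hG]
    have e1 : √(L * (409600 * A * N * G * n)) ≤ √(4 * 102400 * 257 * G) * √(N / n) * Λ * (2 * n) := by
      apply Real.sqrt_le_iff.2
      refine ⟨by positivity, ?_⟩
      have : (√(4 * 102400 * 257 * G) * √(N / n) * Λ * (2 * n)) ^ 2 =
          4 * Λ * (409600 * A * N * G * n) := by
        rw [mul_pow, mul_pow, mul_pow, Real.sq_sqrt (by positivity), Real.sq_sqrt (by positivity), hA]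
        field_simp
        ring
      rw [this]
      gcongr
    have e2 : 80 * n * tk N q L ≤ 40 * √(N / n) * Λ * (2 * n) := by
      have e3 : 1 / (n : ℝ) ≤ √(N / n) := by
        apply Real.le_sqrt_of_sq_le
        rw [div_pow, one_pow, sq, div_le_div_iff₀ (by positivity) (by positivity)]
        nlinarith
      have e4 : 1 / (n : ℝ) ≤ √(N / n) * Λ := by nlinarith [Real.sqrt_nonneg ((N : ℝ) / n)]
      calc 80 * n * tk N q L ≤ 80 * n * (√(N / n) * Λ) := by
            gcongr; exact htL.trans e4
        _ = _ := by ring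
    linarith
  intro c
  set B := av (fun x => ‖ev e c x‖ ^ q) with hB
  have hB0 : 0 ≤ B := av_nonneg fun _ => by positivity
  rcases hB0.eq_or_lt with h | h
  · have hz : ∀ x, ‖ev e c x‖ ^ q = 0 := by
      rw [hB] at h
      unfold av at h
      have hM0 : (M : ℝ) ≠ 0 := by linarith
      have h2 := (div_eq_zero_iff.1 h.symm).resolve_right hM0
      intro x
      exact (Finset.sum_eq_zero_iff_of_nonneg (fun i _ => by positivity)).1 h2 x (Finset.mem_univ _)
    simp only [hz]
    simp [av, ← h]
  · set r : ℝ := B ^ (-(1 / q)) with hr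
    have hr0 : 0 < r := by positivity
    have hrq : r ^ q = B⁻¹ := by
      rw [hr, ← Real.rpow_mul hB0, neg_mul, one_div_mul_cancel (by linarith), Real.rpow_neg_one]
    have hsc : ∀ x, ‖ev e ((r : ℂ) • c) x‖ ^ q = B⁻¹ * ‖ev e c x‖ ^ q := by
      intro x
      rw [ev_smul, norm_mul, Real.mul_rpow (norm_nonneg _) (norm_nonneg _), Complex.norm_real,
        Real.norm_eq_abs, abs_of_pos hr0, hrq]
    have h1 := norm1 ((r : ℂ) • c) (by
      simp only [hsc]; rw [av_mul, ← hB, inv_mul_cancel₀ h.ne'])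
    simp only [hsc] at h1
    rw [av_mul, av_mul, ← mul_sub, abs_mul, abs_of_pos (by positivity : 0 < B⁻¹)] at h1
    rw [inv_mul_le_iff₀ h] at h1
    linarith

end Part5
section Part6

theorem l2_zz {ι κ : Type} [Fintype ι] (e : ι → κ → ℂ) {n : ℕ}
    (a : Fin n × Bool → κ) (b : Fin n → Bool) (R : ℝ)
    (hR : ∀ k l, ‖∑ j, (sgn (b j) : ℂ) * (e k (a (j, true)) * (starRingEnd ℂ) (e l (a (j, true))) -
      e k (a (j, false)) * (starRingEnd ℂ) (e l (a (j, false))))‖ ≤ R) (c : ι → ℂ) :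
    |ZZ b a (fun y => ‖ev e c y‖ ^ 2)| ≤ R * (Fintype.card ι * nrm2 c) := by
  have h0 : ∀ y, ((‖ev e c y‖ ^ 2 : ℝ) : ℂ) =
      ∑ k, ∑ l, c k * (starRingEnd ℂ) (c l) * (e k y * (starRingEnd ℂ) (e l y)) := by
    intro y
    rw [← Complex.normSq_eq_norm_sq, ← Complex.mul_conj]
    unfold ev
    rw [map_sum, Finset.sum_mul_sum]
    refine Finset.sum_congr rfl fun k _ => Finset.sum_congr rfl fun l _ => ?_
    rw [map_mul]; ring
  have h1 : ((ZZ b a (fun y => ‖ev e c y‖ ^ 2) : ℝ) : ℂ) = ∑ k, ∑ l, c k * (starRingEnd ℂ) (c l) *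
      ∑ j, (sgn (b j) : ℂ) * (e k (a (j, true)) * (starRingEnd ℂ) (e l (a (j, true))) -
      e k (a (j, false)) * (starRingEnd ℂ) (e l (a (j, false)))) := by
    unfold ZZ
    rw [Complex.ofReal_sum]
    simp_rw [Complex.ofReal_mul, Complex.ofReal_sub, h0, ← Finset.sum_sub_distrib, Finset.mul_sum]
    rw [Finset.sum_comm]
    refine Finset.sum_congr rfl fun k _ => ?_
    rw [Finset.sum_comm]
    refine Finset.sum_congr rfl fun l _ => Finset.sum_congr rfl fun j _ => ?_
    ring
  have h2 : |ZZ b a (fun y => ‖ev e c y‖ ^ 2)| =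
      ‖((ZZ b a (fun y => ‖ev e c y‖ ^ 2) : ℝ) : ℂ)‖ := by
    rw [Complex.norm_real, Real.norm_eq_abs]
  rw [h2, h1]
  calc _ ≤ ∑ k, ∑ l, ‖c k‖ * ‖c l‖ * R := by
        refine (norm_sum_le _ _).trans (Finset.sum_le_sum fun k _ => ?_)
        refine (norm_sum_le _ _).trans (Finset.sum_le_sum fun l _ => ?_)
        rw [norm_mul, norm_mul, RCLike.norm_conj]
        gcongr
        exact hR k l
    _ = R * (∑ k, ‖c k‖) ^ 2 := by
        rw [sq, Finset.sum_mul_sum, Finset.mul_sum]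
        refine Finset.sum_congr rfl fun k _ => ?_
        rw [Finset.mul_sum]
        exact Finset.sum_congr rfl fun l _ => by ring
    _ ≤ _ := by
        rcases isEmpty_or_nonempty ι with h | h
        · simp
        have hR0 : 0 ≤ R := (norm_nonneg _).trans (hR h.some h.some)
        have := sq_sum_le_card_mul_sum_sq (s := (Finset.univ : Finset ι)) (f := fun k => ‖c k‖)
        gcongr
        simpa [nrm2] using this

theorem pow_sqrt_aux (j : ℕ) : (8 / 7 : ℝ) ^ j ≤ √(2 ^ j) := by
  apply Real.le_sqrt_of_sq_le
  rw [← pow_mul, mul_comm, pow_mul]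
  gcongr; norm_num

theorem pow_quart_aux (j : ℕ) : (8 / 7 : ℝ) ^ j ≤ (2 ^ j : ℝ) ^ (1 / 4 : ℝ) := by
  have h : (8 / 7 : ℝ) ^ j = (((8 / 7 : ℝ) ^ j) ^ (4 : ℕ)) ^ (1 / 4 : ℝ) := by
    rw [← Real.rpow_natCast ((8 / 7 : ℝ) ^ j) 4, ← Real.rpow_mul (by positivity)]
    norm_num
  rw [h]
  apply Real.rpow_le_rpow (by positivity) _ (by norm_num)
  rw [← pow_mul, mul_comm, pow_mul]
  gcongr; norm_num

theorem log_aux (x : ℝ) (hx : 1 ≤ x) : Real.log (8 * x + 1) ≤ 8 * x ^ (1 / 4 : ℝ) := by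
  have h1 : Real.log (8 * x + 1) ≤ Real.log (16 * x) := Real.log_le_log (by linarith) (by linarith)
  have h2 := Real.log_le_rpow_div (x := 16 * x) (by linarith) (by norm_num : (0 : ℝ) < 1 / 4)
  rw [Real.mul_rpow (by norm_num) (by linarith)] at h2
  have h3 : (16 : ℝ) ^ (1 / 4 : ℝ) = 2 := by
    rw [show (16 : ℝ) = 2 ^ (4 : ℝ) by norm_num, ← Real.rpow_mul (by norm_num)]
    norm_num
  rw [h3] at h2
  linarith

theorem av_equiv {κ κ' : Type} [Fintype κ] [Fintype κ'] (f : κ ≃ κ') (g : κ' → ℝ) :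
    av (fun i => g (f i)) = av g := by
  unfold av
  rw [Equiv.sum_comp f g, Fintype.card_congr f]

theorem phase1 (q : ℝ) (hq1 : 1 ≤ q) (hq2 : q < 2) : ∃ K : ℕ, 0 < K ∧
    ∀ (ι Ω : Type) [Fintype ι] (e : ι → Ω → ℂ)
      (_ : ∀ k x, ‖e k x‖ ≤ 1) (_ : 0 < Fintype.card ι) (n : ℕ) (_ : K * Fintype.card ι ^ 4 ≤ n)
      (k : ℕ) (X : Fin (n * 2 ^ k) → Ω) (_ : ∀ c, av (fun i => ‖ev e c (X i)‖ ^ 2) = nrm2 c),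
      ∃ Y : Fin n → Ω, (∀ c, nrm2 c ≤ 2 * av (fun i => ‖ev e c (Y i)‖ ^ 2)) ∧
        ∀ c, |av (fun i => ‖ev e c (Y i)‖ ^ q) - av (fun i => ‖ev e c (X i)‖ ^ q)| ≤
          1 / 2 * av (fun i => ‖ev e c (X i)‖ ^ q) := by
  obtain ⟨C, hC, hhalf⟩ := halving q hq1 hq2
  refine ⟨⌈(256 * C) ^ 4⌉₊ + 16384, by positivity, ?_⟩
  intro ι Ω _ e he hN n hn k X hX
  classical
  set N := Fintype.card ι with hNdef
  have hNr : (1 : ℝ) ≤ N := by exact_mod_cast hN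
  have hn1 : (256 * C) ^ 4 * (N : ℝ) ^ 4 + 16384 * (N : ℝ) ^ 4 ≤ n := by
    have h1 : ((⌈(256 * C) ^ 4⌉₊ + 16384 : ℕ) : ℝ) * (N : ℝ) ^ 4 ≤ n := by exact_mod_cast hn
    push_cast at h1
    have h2 := Nat.le_ceil ((256 * C) ^ 4)
    have h3 : (0 : ℝ) ≤ (N : ℝ) ^ 4 := by positivity
    nlinarith
  have hN4 : (1 : ℝ) ≤ (N : ℝ) ^ 4 := one_le_pow₀ hNr
  have hnN4 : (N : ℝ) ^ 4 ≤ n := by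
    have : 0 ≤ (256 * C) ^ 4 * (N : ℝ) ^ 4 := by positivity
    linarith
  have hnN : (N : ℝ) ≤ n := (le_self_pow₀ hNr (by norm_num)).trans hnN4
  have hnr : (1 : ℝ) ≤ n := hNr.trans hnN
  have hn0 : 0 < n := by exact_mod_cast (by linarith : (0 : ℝ) < n)
  have hroot : 256 * C * √N ≤ (n : ℝ) ^ (1 / 4 : ℝ) := by
    have h1 : 256 * C * √N = ((256 * C * √N) ^ (4 : ℕ)) ^ (1 / 4 : ℝ) := by
      rw [← Real.rpow_natCast (256 * C * √N) 4, ← Real.rpow_mul (by positivity)]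
      norm_num
    rw [h1]
    apply Real.rpow_le_rpow (by positivity) _ (by norm_num)
    have h2 : (√(N : ℝ)) ^ 4 = (N : ℝ) ^ 2 := by
      rw [show (4 : ℕ) = 2 * 2 from rfl, pow_mul, Real.sq_sqrt (by positivity)]
    rw [mul_pow, h2]
    have h3 : (N : ℝ) ^ 2 ≤ (N : ℝ) ^ 4 := pow_le_pow_right₀ hNr (by norm_num)
    have h4 : (256 * C) ^ 4 * (N : ℝ) ^ 2 ≤ (256 * C) ^ 4 * (N : ℝ) ^ 4 := by gcongr
    have : (0 : ℝ) ≤ 16384 * (N : ℝ) ^ 4 := by positivity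
    linarith
  have hsq : 128 * (N : ℝ) ^ 2 ≤ √n := by
    apply Real.le_sqrt_of_sq_le
    have : 0 ≤ (256 * C) ^ 4 * (N : ℝ) ^ 4 := by positivity
    nlinarith
  set B : (ι → ℂ) → ℝ := fun c => av (fun i => ‖ev e c (X i)‖ ^ q) with hB
  have hB0 : ∀ c, 0 ≤ B c := fun c => av_nonneg fun _ => by positivity
  have hstep : ∀ j, ∀ Z : Fin (n * 2 ^ (j + 1)) → Ω,
      ((∀ c, |av (fun i => ‖ev e c (Z i)‖ ^ 2) - nrm2 c| ≤ 1 / 2 * (7 / 8) ^ (j + 1) * nrm2 c) ∧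
        ∀ c, |av (fun i => ‖ev e c (Z i)‖ ^ q) - B c| ≤ 1 / 2 * (7 / 8) ^ (j + 1) * B c) →
      ∃ Y : Fin (n * 2 ^ j) → Ω,
      ((∀ c, |av (fun i => ‖ev e c (Y i)‖ ^ 2) - nrm2 c| ≤ 1 / 2 * (7 / 8) ^ j * nrm2 c) ∧
        ∀ c, |av (fun i => ‖ev e c (Y i)‖ ^ q) - B c| ≤ 1 / 2 * (7 / 8) ^ j * B c) := by
    rintro j Z ⟨hZ2, hZq⟩
    have hp1 : (7 / 8 : ℝ) ^ (j + 1) ≤ 1 := pow_le_one₀ (by norm_num) (by norm_num)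
    set nj := n * 2 ^ j with hnj
    have hnj0 : 0 < nj := by positivity
    have hnjr : (nj : ℝ) = n * 2 ^ j := by rw [hnj]; push_cast; ring
    have hnn : n ≤ nj := Nat.le_mul_of_pos_right _ (by positivity)
    have hnj1 : (1 : ℝ) ≤ nj := by exact_mod_cast hnj0
    have hcard : Fintype.card (Fin nj × Bool) = Fintype.card (Fin (n * 2 ^ (j + 1))) := by
      simp [hnj, pow_succ, mul_assoc]
    let a : Fin nj × Bool ≃ Fin (n * 2 ^ (j + 1)) := Fintype.equivOfCardEq hcard
    let e' : ι → Fin (n * 2 ^ (j + 1)) → ℂ := fun k i => e k (Z i)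
    have hev : ∀ c i, ev e' c i = ev e c (Z i) := fun c i => rfl
    let E : ι → ι → Fin (n * 2 ^ (j + 1)) → ℂ := fun k l i => e' k i * (starRingEnd ℂ) (e' l i)
    have hE : ∀ k l i, ‖E k l i‖ ≤ 1 := by
      intro k l i
      simp only [E]
      rw [norm_mul, RCLike.norm_conj]
      exact mul_le_one₀ (he _ _) (norm_nonneg _) (he _ _)
    let w : ι × ι × Bool → Fin nj → ℝ := fun s i =>
      if s.2.2 then (E s.1 s.2.1 (a (i, true)) - E s.1 s.2.1 (a (i, false))).re
      else (E s.1 s.2.1 (a (i, true)) - E s.1 s.2.1 (a (i, false))).im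
    have hw : ∀ s, √(∑ i, w s i ^ 2) ≤ 2 * √nj := by
      intro s
      have h1 : ∀ i, w s i ^ 2 ≤ 4 := by
        intro i
        have h2 : ‖E s.1 s.2.1 (a (i, true)) - E s.1 s.2.1 (a (i, false))‖ ≤ 2 := by
          refine (norm_sub_le _ _).trans ?_
          linarith [hE s.1 s.2.1 (a (i, true)), hE s.1 s.2.1 (a (i, false))]
        have h3 : |w s i| ≤ 2 := by
          simp only [w]
          split_ifs
          · exact (Complex.abs_re_le_norm _).trans h2
          · exact (Complex.abs_im_le_norm _).trans h2
        rw [← sq_abs]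
        nlinarith [abs_nonneg (w s i)]
      apply Real.sqrt_le_iff.2
      refine ⟨by positivity, ?_⟩
      rw [mul_pow, Real.sq_sqrt (by positivity)]
      calc ∑ i, w s i ^ 2 ≤ ∑ i : Fin nj, (4 : ℝ) := Finset.sum_le_sum fun i _ => h1 i
        _ = _ := by simp; ring
    obtain ⟨b, hbq, hbw⟩ := hhalf ι (Fin (n * 2 ^ (j + 1))) (ι × ι × Bool) e' (fun k x => he _ _) hN
      (by rw [Fintype.card_fin]
          have h1 : N ≤ n := by exact_mod_cast hnN
          exact h1.trans (Nat.le_mul_of_pos_right _ (by positivity)))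
      (fun c => by
        simp only [hev]
        have h1 := (abs_le.1 (hZ2 c)).1
        have h2 := nrm2_nonneg c
        have : 1 / 2 * (7 / 8) ^ (j + 1) * nrm2 c ≤ 1 / 2 * 1 * nrm2 c := by gcongr
        linarith)
      nj hnj0 (by rw [Fintype.card_fin, pow_succ, ← mul_assoc, ← hnj]; omega) a
      (fun c => by
        simp only [hev]
        rw [av_equiv a (fun i => ‖ev e c (Z i)‖ ^ q)]
        have : 0 ≤ av (fun i => ‖ev e c (Z i)‖ ^ q) := av_nonneg fun _ => by positivity
        linarith) w (fun _ => 4 * N) (fun _ => by positivity)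
      (by
        simp only [Finset.sum_const, Finset.card_univ, Fintype.card_prod, Fintype.card_bool,
          nsmul_eq_mul]
        rw [← hNdef]
        push_cast
        have h1 := Real.add_one_le_exp (8 * (N : ℝ) ^ 2)
        have h2 : -(4 * (N : ℝ)) ^ 2 / 2 = -(8 * (N : ℝ) ^ 2) := by ring
        rw [h2, Real.exp_neg]
        have h3 := Real.exp_pos (8 * (N : ℝ) ^ 2)
        have h4 : (N : ℝ) * (N * 2) * (2 * (Real.exp (8 * (N : ℝ) ^ 2))⁻¹) =
          (4 * (N : ℝ) ^ 2) / Real.exp (8 * (N : ℝ) ^ 2) := by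
            rw [div_eq_mul_inv]; ring
        rw [h4, div_le_iff₀ h3]
        linarith)
    refine ⟨fun i => Z (a (i, b i)), ?_, ?_⟩
    · intro c
      have h1 := l2_zz e' a b (16 * N * √nj) (fun k l => by
        have hre := hbw (k, l, true)
        have him := hbw (k, l, false)
        simp only [w, if_true, if_false, Bool.false_eq_true] at hre him
        refine (Complex.norm_le_abs_re_add_abs_im _).trans ?_
        rw [Complex.re_sum, Complex.im_sum]
        simp only [Complex.re_ofReal_mul, Complex.im_ofReal_mul]
        have hw1 := hw (k, l, true)
        have hw2 := hw (k, l, false)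
        simp only [w, if_true, if_false, Bool.false_eq_true] at hw1 hw2
        have hre' := hre.trans (mul_le_mul_of_nonneg_left hw1 (by positivity))
        have him' := him.trans (mul_le_mul_of_nonneg_left hw2 (by positivity))
        refine (add_le_add hre' him').trans (le_of_eq ?_)
        ring) c
      have h2 := av_half b a (fun i => ‖ev e c (Z i)‖ ^ 2)
      have h3 := av_equiv a (fun i => ‖ev e c (Z i)‖ ^ 2)
      have h4 := hZ2 c
      have h5 : |ZZ b a (fun i => ‖ev e c (Z i)‖ ^ 2) / (2 * nj)| ≤ 1 / 16 * (7 / 8) ^ j * nrm2 c := by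
        rw [abs_div, abs_of_pos (by positivity : (0 : ℝ) < 2 * nj), div_le_iff₀ (by positivity)]
        refine h1.trans ?_
        rw [← hNdef]
        have h6 : 128 * (N : ℝ) ^ 2 * (8 / 7) ^ j ≤ √nj := by
          rw [hnjr, Real.sqrt_mul (by positivity)]
          have := pow_sqrt_aux j
          gcongr
        have h7 : (7 / 8 : ℝ) ^ j * (8 / 7) ^ j = 1 := by
          rw [← mul_pow]; norm_num
        have h8 : 128 * (N : ℝ) ^ 2 ≤ (7 / 8) ^ j * √nj := by
          calc 128 * (N : ℝ) ^ 2 = (7 / 8 : ℝ) ^ j * (128 * (N : ℝ) ^ 2 * (8 / 7) ^ j) := by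
                linear_combination (-128 * (N : ℝ) ^ 2) * h7
            _ ≤ _ := by gcongr
        have h9 : (nj : ℝ) = √nj * √nj := (Real.mul_self_sqrt (by positivity)).symm
        calc 16 * N * √nj * (N * nrm2 c) = (128 * (N : ℝ) ^ 2) * (1 / 8 * √nj * nrm2 c) := by ring
          _ ≤ ((7 / 8) ^ j * √nj) * (1 / 8 * √nj * nrm2 c) := by
              have := nrm2_nonneg c
              gcongr
          _ = 1 / 16 * (7 / 8) ^ j * nrm2 c * (2 * (√nj * √nj)) := by ring
          _ = _ := by rw [← h9]
      rw [h3] at h2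
      have h6 : av (fun i => ‖ev e c (Z (a (i, b i)))‖ ^ 2) - nrm2 c =
        ZZ b a (fun i => ‖ev e c (Z i)‖ ^ 2) / (2 * nj) +
          (av (fun i => ‖ev e c (Z i)‖ ^ 2) - nrm2 c) := by linarith
      rw [h6]
      refine (abs_add_le _ _).trans ((add_le_add h5 h4).trans (le_of_eq ?_))
      ring
    · intro c
      have h1 := hbq c
      simp only [hev] at h1
      rw [av_equiv a (fun i => ‖ev e c (Z i)‖ ^ q)] at h1
      have h4 := hZq c
      have h2 : av (fun i => ‖ev e c (Z i)‖ ^ q) ≤ 2 * B c := by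
        have h3 := (abs_le.1 h4).2
        have : 1 / 2 * (7 / 8) ^ (j + 1) * B c ≤ 1 / 2 * 1 * B c := by
          have := hB0 c
          gcongr
        linarith [hB0 c]
      have h5 : C * √(N / nj) * Real.log (4 * Fintype.card (Fin (n * 2 ^ (j + 1))) + 1) ≤
          1 / 32 * (7 / 8) ^ j := by
        have hc : (4 * (Fintype.card (Fin (n * 2 ^ (j + 1))) : ℝ) + 1) = 8 * nj + 1 := by
          rw [Fintype.card_fin, hnjr]; push_cast; ring
        rw [hc]
        have h6 := log_aux nj hnj1
        set y : ℝ := (nj : ℝ) ^ (1 / 4 : ℝ) with hy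
        have hy0 : 0 < y := by positivity
        have hyy : √(nj : ℝ) = y * y := by
          rw [hy, ← Real.rpow_add (by positivity), Real.sqrt_eq_rpow]; norm_num
        have h7 : 256 * C * √N * (8 / 7) ^ j ≤ y := by
          rw [hy, hnjr, Real.mul_rpow (by positivity) (by positivity)]
          have := pow_quart_aux j
          gcongr
        have h7' : (7 / 8 : ℝ) ^ j * (8 / 7) ^ j = 1 := by
          rw [← mul_pow]; norm_num
        have h8 : 256 * C * √N ≤ (7 / 8) ^ j * y := by
          calc 256 * C * √N = (7 / 8 : ℝ) ^ j * (256 * C * √N * (8 / 7) ^ j) := by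
                linear_combination (-256 * C * √N) * h7'
            _ ≤ _ := by gcongr
        rw [Real.sqrt_div (by positivity), hyy]
        calc C * (√N / (y * y)) * Real.log (8 * nj + 1) ≤ C * (√N / (y * y)) * (8 * y) := by gcongr
          _ = (256 * C * √N) / (32 * y) := by field_simp; ring
          _ ≤ ((7 / 8) ^ j * y) / (32 * y) := by gcongr
          _ = _ := by field_simp
      have h6 : |av (fun i => ‖ev e c (Z (a (i, b i)))‖ ^ q) - av (fun i => ‖ev e c (Z i)‖ ^ q)| ≤
          1 / 16 * (7 / 8) ^ j * B c := by
        refine h1.trans ?_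
        calc _ ≤ (1 / 32 * (7 / 8) ^ j) * (2 * B c) := by
              apply mul_le_mul h5 h2 (av_nonneg fun _ => by positivity) (by positivity)
          _ = _ := by ring
      have h7 : av (fun i => ‖ev e c (Z (a (i, b i)))‖ ^ q) - B c =
        (av (fun i => ‖ev e c (Z (a (i, b i)))‖ ^ q) - av (fun i => ‖ev e c (Z i)‖ ^ q)) +
          (av (fun i => ‖ev e c (Z i)‖ ^ q) - B c) := by ring
      rw [h7]
      refine (abs_add_le _ _).trans ((add_le_add h6 h4).trans (le_of_eq ?_))
      ring
  have hiter : ∀ j, ∀ Z : Fin (n * 2 ^ j) → Ω,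
      ((∀ c, |av (fun i => ‖ev e c (Z i)‖ ^ 2) - nrm2 c| ≤ 1 / 2 * (7 / 8) ^ j * nrm2 c) ∧
        ∀ c, |av (fun i => ‖ev e c (Z i)‖ ^ q) - B c| ≤ 1 / 2 * (7 / 8) ^ j * B c) →
      ∃ Y : Fin (n * 2 ^ 0) → Ω,
      ((∀ c, |av (fun i => ‖ev e c (Y i)‖ ^ 2) - nrm2 c| ≤ 1 / 2 * (7 / 8) ^ 0 * nrm2 c) ∧
        ∀ c, |av (fun i => ‖ev e c (Y i)‖ ^ q) - B c| ≤ 1 / 2 * (7 / 8) ^ 0 * B c) := by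
    intro j
    induction j with
    | zero => exact fun Z hZ => ⟨Z, hZ⟩
    | succ j ih =>
      intro Z hZ
      obtain ⟨Y, hY⟩ := hstep j Z hZ
      exact ih Y hY
  obtain ⟨Y, hY2, hYq⟩ := hiter k X ⟨fun c => by
      rw [hX c, sub_self, abs_zero]
      have := nrm2_nonneg c
      positivity, fun c => by
      have := hB0 c
      simp only [hB, sub_self, abs_zero] at this ⊢
      positivity⟩
  let f : Fin n ≃ Fin (n * 2 ^ 0) := finCongr (by simp)
  refine ⟨fun i => Y (f i), fun c => ?_, fun c => ?_⟩
  · rw [av_equiv f (fun i => ‖ev e c (Y i)‖ ^ 2)]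
    have h := (abs_le.1 (hY2 c)).1
    simp only [pow_zero] at h
    linarith
  · rw [av_equiv f (fun i => ‖ev e c (Y i)‖ ^ q)]
    simpa using hYq c

end Part6
section Part7

theorem phase2 (q : ℝ) (hq1 : 1 ≤ q) (hq2 : q < 2) : ∃ C : ℝ, 0 < C ∧
    ∀ (ι Ω : Type) [Fintype ι] (e : ι → Ω → ℂ)
      (_ : ∀ k x, ‖e k x‖ ≤ 1) (_ : 0 < Fintype.card ι) (m k : ℕ) (_ : Fintype.card ι ≤ m)
      (Y : Fin (m * 2 ^ k) → Ω)
      (_ : C * √(Fintype.card ι / m) * Real.log (4 * (m * 2 ^ k) + 1) ≤ 1 / 16)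
      (_ : ∀ c, nrm2 c ≤ 2 * av (fun i => ‖ev e c (Y i)‖ ^ 2)),
      ∃ X : Fin m → Ω,
        ∀ c, |av (fun i => ‖ev e c (X i)‖ ^ q) - av (fun i => ‖ev e c (Y i)‖ ^ q)| ≤
          1 / 2 * av (fun i => ‖ev e c (Y i)‖ ^ q) := by
  obtain ⟨C, hC, hhalf⟩ := halving q hq1 hq2
  refine ⟨C, hC, ?_⟩
  intro ι Ω _ e he hN m k hNm Y hlog hY
  set N := Fintype.card ι with hNdef
  have hm0 : 0 < m := lt_of_lt_of_le hN hNm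
  set B : (ι → ℂ) → ℝ := fun c => av (fun i => ‖ev e c (Y i)‖ ^ q) with hB
  have hB0 : ∀ c, 0 ≤ B c := fun c => av_nonneg fun _ => by positivity
  let e' : ι → Fin (m * 2 ^ k) → ℂ := fun k i => e k (Y i)
  have hev : ∀ c i, ev e' c i = ev e c (Y i) := fun c i => rfl
  have hstep : ∀ j, j + 1 ≤ k → ∀ Z : Fin (m * 2 ^ (j + 1)) → Fin (m * 2 ^ k),
      (∀ c, |av (fun i => ‖ev e c (Y (Z i))‖ ^ q) - B c| ≤ 1 / 2 * (7 / 8) ^ (j + 1) * B c) →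
      ∃ X : Fin (m * 2 ^ j) → Fin (m * 2 ^ k),
        ∀ c, |av (fun i => ‖ev e c (Y (X i))‖ ^ q) - B c| ≤ 1 / 2 * (7 / 8) ^ j * B c := by
    intro j hjk Z hZq
    have hp1 : (7 / 8 : ℝ) ^ (j + 1) ≤ 1 := pow_le_one₀ (by norm_num) (by norm_num)
    set nj := m * 2 ^ j with hnj
    have hnj0 : 0 < nj := by positivity
    have hnjr : (nj : ℝ) = m * 2 ^ j := by rw [hnj]; push_cast; ring
    have hcard : Fintype.card (Fin nj × Bool) = Fintype.card (Fin (m * 2 ^ (j + 1))) := by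
      simp [hnj, pow_succ, mul_assoc]
    let a : Fin nj × Bool ≃ Fin (m * 2 ^ (j + 1)) := Fintype.equivOfCardEq hcard
    have hZB : ∀ c, av (fun i => ‖ev e c (Y (Z i))‖ ^ q) ≤ 2 * B c := by
      intro c
      have h3 := (abs_le.1 (hZq c)).2
      have : 1 / 2 * (7 / 8) ^ (j + 1) * B c ≤ 1 / 2 * 1 * B c := by
        have := hB0 c
        gcongr
      linarith [hB0 c]
    obtain ⟨b, hbq, -⟩ := hhalf ι (Fin (m * 2 ^ k)) Empty e' (fun k x => he _ _) hN
      (by rw [Fintype.card_fin]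
          exact hNm.trans (Nat.le_mul_of_pos_right _ (by positivity)))
      (fun c => by
        simp only [hev]
        exact hY c)
      nj hnj0 (by
        rw [Fintype.card_fin]
        exact Nat.mul_le_mul_left _ (Nat.pow_le_pow_right (by norm_num) (by omega)))
      (fun p => Z (a p))
      (fun c => by
        simp only [hev]
        rw [av_equiv a (fun i => ‖ev e c (Y (Z i))‖ ^ q)]
        have h1 := hZB c
        have h2 := hB0 c
        simp only [hB] at h1 h2
        linarith) (fun s => s.elim) (fun s => s.elim) (fun s => s.elim) (by simp)
    refine ⟨fun i => Z (a (i, b i)), ?_⟩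
    intro c
    have h1 := hbq c
    simp only [hev] at h1
    rw [av_equiv a (fun i => ‖ev e c (Y (Z i))‖ ^ q)] at h1
    have h4 := hZq c
    have h5 : C * √(N / nj) * Real.log (4 * Fintype.card (Fin (m * 2 ^ k)) + 1) ≤
        1 / 16 * (7 / 8) ^ j := by
      rw [Fintype.card_fin]
      push_cast
      have h7 : √((N : ℝ) / nj) ≤ √((N : ℝ) / m) * (7 / 8) ^ j := by
        have h7' : (7 / 8 : ℝ) ^ j = ((8 / 7) ^ j)⁻¹ := by
          rw [← inv_pow]; norm_num
        rw [hnjr, ← div_div, Real.sqrt_div (by positivity), h7', div_eq_mul_inv]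
        have := pow_sqrt_aux j
        gcongr
      have hl : 0 ≤ Real.log (4 * ((m : ℝ) * 2 ^ k) + 1) :=
        Real.log_nonneg (by have : (0 : ℝ) ≤ m * 2 ^ k := by positivity
                            linarith)
      calc _ ≤ C * (√((N : ℝ) / m) * (7 / 8) ^ j) * Real.log (4 * ((m : ℝ) * 2 ^ k) + 1) := by
            gcongr
        _ = (C * √((N : ℝ) / m) * Real.log (4 * ((m : ℝ) * 2 ^ k) + 1)) * (7 / 8) ^ j := by ring
        _ ≤ _ := by gcongr
    have h6 : |av (fun i => ‖ev e c (Y (Z (a (i, b i))))‖ ^ q) -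
        av (fun i => ‖ev e c (Y (Z i))‖ ^ q)| ≤ 1 / 16 * (7 / 8) ^ j * B c :=
      h1.trans (mul_le_mul_of_nonneg_right h5 (hB0 c))
    have h7 : av (fun i => ‖ev e c (Y (Z (a (i, b i))))‖ ^ q) - B c =
      (av (fun i => ‖ev e c (Y (Z (a (i, b i))))‖ ^ q) - av (fun i => ‖ev e c (Y (Z i))‖ ^ q)) +
        (av (fun i => ‖ev e c (Y (Z i))‖ ^ q) - B c) := by ring
    rw [h7]
    refine (abs_add_le _ _).trans ((add_le_add h6 h4).trans (le_of_eq ?_))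
    ring
  have hiter : ∀ j, j ≤ k → ∀ Z : Fin (m * 2 ^ j) → Fin (m * 2 ^ k),
      (∀ c, |av (fun i => ‖ev e c (Y (Z i))‖ ^ q) - B c| ≤ 1 / 2 * (7 / 8) ^ j * B c) →
      ∃ X : Fin (m * 2 ^ 0) → Fin (m * 2 ^ k),
        ∀ c, |av (fun i => ‖ev e c (Y (X i))‖ ^ q) - B c| ≤ 1 / 2 * (7 / 8) ^ 0 * B c := by
    intro j
    induction j with
    | zero => exact fun _ Z hZ => ⟨Z, hZ⟩
    | succ j ih =>
      intro hj Z hZ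
      obtain ⟨X, hX⟩ := hstep j hj Z hZ
      exact ih (by omega) X hX
  obtain ⟨X, hX⟩ := hiter k le_rfl id (fun c => by
      have := hB0 c
      simp only [hB, id, sub_self, abs_zero] at this ⊢
      positivity)
  let f : Fin m ≃ Fin (m * 2 ^ 0) := finCongr (by simp)
  refine ⟨fun i => Y (X (f i)), fun c => ?_⟩
  rw [av_equiv f (fun i => ‖ev e c (Y (X i))‖ ^ q)]
  simpa using hX c

theorem numeric (C : ℝ) (hC : 0 < C) (K : ℕ) (hK : 0 < K) : ∃ C1 : ℝ, 0 < C1 ∧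
    ∀ N m : ℕ, 0 < N → C1 * N * Real.log (2 * N) ^ 2 ≤ m → N ≤ m ∧
      ∀ M : ℝ, 0 ≤ M → M ≤ m + 2 * K * N ^ 4 →
        C * √(N / m) * Real.log (4 * M + 1) ≤ 1 / 16 := by
  have hKr : (1 : ℝ) ≤ K := by exact_mod_cast hK
  set A : ℝ := 5 + 2 * Real.log (13 * K) with hA
  have hlK : 0 ≤ Real.log (13 * K) := Real.log_nonneg (by linarith)
  refine ⟨4 * (128 * C) ^ 4 + (32 * C * A) ^ 2 + 4, by positivity, ?_⟩
  intro N m hN hm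
  have hNr : (1 : ℝ) ≤ N := by exact_mod_cast hN
  have hL : 1 / 2 ≤ Real.log (2 * N) := by
    have h1 : Real.log 2 ≤ Real.log (2 * N) := Real.log_le_log (by norm_num) (by linarith)
    linarith [Real.log_two_gt_d9]
  have hLN : Real.log N ≤ Real.log (2 * N) := Real.log_le_log (by linarith) (by linarith)
  set L := Real.log (2 * N) with hLdef
  set r : ℝ := m / N with hr
  have hmr : (m : ℝ) = r * N := by rw [hr]; field_simp
  have hr1 : (4 * (128 * C) ^ 4 + (32 * C * A) ^ 2 + 4) * L ^ 2 ≤ r := by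
    rw [hr, le_div_iff₀ (by linarith)]
    linarith
  have hL2 : 1 / 4 ≤ L ^ 2 := by nlinarith
  have p1 : 0 ≤ (128 * C) ^ 4 := by positivity
  have p2 : 0 ≤ (32 * C * A) ^ 2 := by positivity
  have hr2 : (128 * C) ^ 4 ≤ r := by nlinarith
  have hr3 : (32 * C * A * L) ^ 2 ≤ r := by rw [mul_pow]; nlinarith
  have hr4 : 1 ≤ r := by nlinarith
  have hNm : (N : ℝ) ≤ m := by rw [hmr]; nlinarith
  refine ⟨by exact_mod_cast hNm, ?_⟩
  intro M hM0 hM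
  have hN4 : (1 : ℝ) ≤ (N : ℝ) ^ 4 := one_le_pow₀ hNr
  have hm1 : (1 : ℝ) ≤ m := hNr.trans hNm
  have hKm : (1 : ℝ) ≤ K * m := one_le_mul_of_one_le_of_one_le hKr hm1
  have hKN : (1 : ℝ) ≤ K * N ^ 4 := one_le_mul_of_one_le_of_one_le hKr hN4
  have hb : 4 * M + 1 ≤ 13 * K * r * N ^ 5 := by
    have e1 : (m : ℝ) ≤ m * (K * N ^ 4) := le_mul_of_one_le_right (by linarith) hKN
    have e2 : K * (N : ℝ) ^ 4 ≤ m * (K * N ^ 4) := le_mul_of_one_le_left (by linarith) hm1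
    have e3 : 13 * K * r * N ^ 5 = 13 * (m * (K * (N : ℝ) ^ 4)) := by rw [hmr]; ring
    rw [e3]; linarith
  have hlog : Real.log (4 * M + 1) ≤ Real.log (13 * K) + Real.log r + 5 * Real.log N := by
    refine (Real.log_le_log (by linarith) hb).trans (le_of_eq ?_)
    rw [Real.log_mul (by positivity) (by positivity), Real.log_mul (by positivity) (by positivity),
      Real.log_pow]
    norm_num
  have hlr := Real.log_le_rpow_div (x := r) (by linarith) (by norm_num : (0 : ℝ) < 1 / 4)
  set y : ℝ := r ^ (1 / 4 : ℝ) with hy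
  have hy0 : 0 < y := by positivity
  have hyy : √r = y * y := by
    rw [hy, ← Real.rpow_add (by positivity), Real.sqrt_eq_rpow]; norm_num
  have hy1 : 128 * C ≤ y := by
    have h1 : 128 * C = ((128 * C) ^ (4 : ℕ)) ^ (1 / 4 : ℝ) := by
      rw [← Real.rpow_natCast (128 * C) 4, ← Real.rpow_mul (by positivity)]
      norm_num
    rw [h1]
    exact Real.rpow_le_rpow (by positivity) hr2 (by norm_num)
  have hs : 32 * C * A * L ≤ √r := Real.le_sqrt_of_sq_le hr3
  have hlog2 : Real.log (4 * M + 1) ≤ 4 * y + A * L := by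
    have : Real.log (13 * K) ≤ 2 * Real.log (13 * K) * L := by nlinarith
    rw [hA]
    linarith
  have hNmr : √((N : ℝ) / m) = (√r)⁻¹ := by
    rw [← Real.sqrt_inv, hr, inv_div]
  rw [hNmr]
  have hsr : 0 < √r := by positivity
  calc C * (√r)⁻¹ * Real.log (4 * M + 1) ≤ C * (√r)⁻¹ * (4 * y + A * L) := by gcongr
    _ = (C * (4 * y + A * L)) / √r := by rw [div_eq_mul_inv]; ring
    _ ≤ 1 / 16 := by
      rw [div_le_iff₀ hsr]
      have : 128 * C * y ≤ √r := by rw [hyy]; gcongr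
      linarith

theorem abstract_thm (q : ℝ) (hq1 : 1 ≤ q) (hq2 : q < 2) : ∃ C1 : ℝ, 0 < C1 ∧
    ∀ (ι Ω : Type) [Fintype ι] (e : ι → Ω → ℂ)
      (_ : ∀ k x, ‖e k x‖ ≤ 1) (_ : 0 < Fintype.card ι) (J : (ι → ℂ) → ℝ)
      (_ : ∀ n : ℕ, 0 < n → ∃ k : ℕ, ∃ X : Fin (n * 2 ^ k) → Ω,
        (∀ c, av (fun i => ‖ev e c (X i)‖ ^ 2) = nrm2 c) ∧
        ∀ c, 1 / 2 * J c ≤ av (fun i => ‖ev e c (X i)‖ ^ q) ∧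
          av (fun i => ‖ev e c (X i)‖ ^ q) ≤ 2 * J c)
      (m : ℕ) (_ : C1 * Fintype.card ι * Real.log (2 * Fintype.card ι) ^ 2 ≤ m),
      ∃ X : Fin m → Ω, ∀ c, 1 / 8 * J c ≤ av (fun i => ‖ev e c (X i)‖ ^ q) ∧
          av (fun i => ‖ev e c (X i)‖ ^ q) ≤ 5 * J c := by
  obtain ⟨K, hK, h1⟩ := phase1 q hq1 hq2
  obtain ⟨C, hC, h2⟩ := phase2 q hq1 hq2
  obtain ⟨C1, hC1, hnum⟩ := numeric C hC K hK
  refine ⟨C1, hC1, ?_⟩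
  intro ι Ω _ e he hN J hJ m hm
  obtain ⟨hNm, hlog⟩ := hnum _ m hN hm
  have hm0 : 0 < m := lt_of_lt_of_le hN hNm
  set N := Fintype.card ι with hNdef
  have hex : ∃ k, K * N ^ 4 ≤ m * 2 ^ k :=
    ⟨K * N ^ 4, (Nat.lt_two_pow_self).le.trans (Nat.le_mul_of_pos_left _ hm0)⟩
  obtain ⟨k, hk1, hk2⟩ : ∃ k, K * N ^ 4 ≤ m * 2 ^ k ∧ m * 2 ^ k ≤ m + 2 * K * N ^ 4 := by
    classical
    refine ⟨Nat.find hex, Nat.find_spec hex, ?_⟩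
    rcases hf : Nat.find hex with _ | j
    · simp
    · have := Nat.find_min hex (m := j) (by omega)
      push Not at this
      rw [pow_succ]
      nlinarith
  obtain ⟨k', X, hX2, hXq⟩ := hJ (m * 2 ^ k) (by positivity)
  obtain ⟨Y, hY2, hYq⟩ := h1 ι Ω e he hN (m * 2 ^ k) hk1 k' X hX2
  obtain ⟨Z, hZ⟩ := h2 ι Ω e he hN m k hNm Y (hlog _ (by positivity) (by exact_mod_cast hk2)) hY2
  refine ⟨Z, fun c => ?_⟩
  have a1 := abs_le.1 (hZ c)
  have a2 := abs_le.1 (hYq c)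
  have a3 := hXq c
  constructor <;> linarith [a1.1, a1.2, a2.1, a2.2, a3.1, a3.2]

end Part7
section Part8

/-- Grid point. -/
def gp {d K : ℕ} (a : Fin d → Fin K) : Fin d → ℝ := fun j => 2 * Real.pi / K * ((a j : ℕ) : ℝ)

/-- Grid box. -/
def gb {d K : ℕ} (a : Fin d → Fin K) : Set (Fin d → ℝ) :=
  Set.univ.pi fun j => Set.Ico (2 * Real.pi / K * ((a j : ℕ) : ℝ))
    (2 * Real.pi / K * (((a j : ℕ) : ℝ) + 1))

theorem gp_mem {d K : ℕ} (a : Fin d → Fin K) : gp a ∈ torusCell d := by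
  intro j _
  have hK : 0 < K := lt_of_le_of_lt (Nat.zero_le _) (a j).2
  have hKr : (0 : ℝ) < K := by exact_mod_cast hK
  have h : (((a j : ℕ) : ℝ)) < K := by exact_mod_cast (a j).2
  have hpi := Real.pi_pos
  refine ⟨by unfold gp; positivity, ?_⟩
  unfold gp
  rw [div_mul_eq_mul_div, div_lt_iff₀ hKr]
  gcongr

theorem gb_iUnion {d K : ℕ} (hK : 0 < K) : ⋃ a : Fin d → Fin K, gb a = torusCell d := by
  have hKr : (0 : ℝ) < K := by exact_mod_cast hK
  have hpi := Real.pi_pos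
  have hh : 0 < 2 * Real.pi / K := by positivity
  ext x
  simp only [Set.mem_iUnion]
  constructor
  · rintro ⟨a, ha⟩ j _
    have h1 := ha j trivial
    have h : (((a j : ℕ) : ℝ)) + 1 ≤ K := by exact_mod_cast (a j).2
    refine ⟨le_trans (by positivity) h1.1, lt_of_lt_of_le h1.2 ?_⟩
    rw [div_mul_eq_mul_div, div_le_iff₀ hKr]
    gcongr
  · intro hx
    have hx' : ∀ j, 0 ≤ x j ∧ x j < 2 * Real.pi := fun j => hx j trivial
    have hlt : ∀ j, ⌊x j / (2 * Real.pi / K)⌋₊ < K := by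
      intro j
      rw [Nat.floor_lt (div_nonneg (hx' j).1 hh.le), div_lt_iff₀ hh]
      have : (K : ℝ) * (2 * Real.pi / K) = 2 * Real.pi := by field_simp
      rw [this]
      exact (hx' j).2
    refine ⟨fun j => ⟨_, hlt j⟩, fun j _ => ?_⟩
    have h0 := div_nonneg (hx' j).1 hh.le
    have h1 := Nat.floor_le h0
    have h2 := Nat.lt_floor_add_one (x j / (2 * Real.pi / K))
    rw [le_div_iff₀ hh] at h1
    rw [div_lt_iff₀ hh] at h2
    constructor
    · simp only; linarith
    · simp only; linarith

theorem gb_disj {d K : ℕ} (hK : 0 < K) :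
    Pairwise (Function.onFun Disjoint (gb : (Fin d → Fin K) → Set (Fin d → ℝ))) := by
  have hKr : (0 : ℝ) < K := by exact_mod_cast hK
  have hpi := Real.pi_pos
  have hh : 0 < 2 * Real.pi / K := by positivity
  intro a b hab
  rw [Function.onFun, Set.disjoint_left]
  intro x hxa hxb
  apply hab
  funext j
  have h1 := hxa j trivial
  have h2 := hxb j trivial
  have h3 := lt_of_mul_lt_mul_left (h1.1.trans_lt h2.2) hh.le
  have h4 := lt_of_mul_lt_mul_left (h2.1.trans_lt h1.2) hh.le
  have h5 : (a j : ℕ) < (b j : ℕ) + 1 := by exact_mod_cast h3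
  have h6 : (b j : ℕ) < (a j : ℕ) + 1 := by exact_mod_cast h4
  exact Fin.ext (by omega)

theorem gb_meas {d K : ℕ} (a : Fin d → Fin K) : MeasurableSet (gb a) :=
  MeasurableSet.univ_pi fun _ => measurableSet_Ico

theorem gb_vol {d K : ℕ} (hK : 0 < K) (a : Fin d → Fin K) :
    volume (gb a) = ENNReal.ofReal ((2 * Real.pi / K) ^ d) := by
  have hpi := Real.pi_pos
  unfold gb
  rw [Real.volume_pi_Ico]
  have : ∀ j, 2 * Real.pi / K * (((a j : ℕ) : ℝ) + 1) - 2 * Real.pi / K * ((a j : ℕ) : ℝ) =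
    2 * Real.pi / K := fun j => by ring
  simp only [this, Finset.prod_const, Finset.card_univ, Fintype.card_fin]
  rw [ENNReal.ofReal_pow (by positivity)]

theorem riemann {d K : ℕ} (hK : 0 < K) (h : (Fin d → ℝ) → ℝ) (hc : Continuous h) (δ : ℝ)
    (hδ : ∀ a : Fin d → Fin K, ∀ x ∈ gb a, |h x - h (gp a)| ≤ δ) :
    |∫ x, h x ∂(torusMeasure d) - av (fun a : Fin d → Fin K => h (gp a))| ≤ δ := by
  have hpi := Real.pi_pos
  have hKr : (0 : ℝ) < K := by exact_mod_cast hK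
  set v : ℝ := (2 * Real.pi / K) ^ d with hv
  have hv0 : 0 < v := by positivity
  have hfin : ∀ a : Fin d → Fin K, volume (gb a) < ⊤ := fun a => by
    rw [gb_vol hK]; exact ENNReal.ofReal_lt_top
  have hIntg : ∀ a : Fin d → Fin K, IntegrableOn h (gb a) := by
    intro a
    have hcomp : IsCompact (Set.univ.pi fun j => Set.Icc (2 * Real.pi / K * ((a j : ℕ) : ℝ))
      (2 * Real.pi / K * (((a j : ℕ) : ℝ) + 1))) := isCompact_univ_pi fun _ => isCompact_Icc
    exact (hc.continuousOn.integrableOn_compact hcomp).mono_set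
      (Set.pi_mono fun _ _ => Set.Ico_subset_Icc_self)
  have hJ : ∫ x, h x ∂(torusMeasure d) = ((2 * Real.pi) ^ d)⁻¹ * ∑ a : Fin d → Fin K, ∫ x in gb a, h x := by
    unfold torusMeasure
    rw [integral_smul_measure, ← gb_iUnion hK, integral_iUnion_fintype gb_meas (gb_disj hK) hIntg,
      ENNReal.toReal_inv, ENNReal.toReal_ofReal (by positivity), smul_eq_mul]
  have hbox : ∀ a : Fin d → Fin K, |∫ x in gb a, h x - h (gp a)| ≤ δ * v := by
    intro a
    have h1 := norm_setIntegral_le_of_norm_le_const (f := fun x => h x - h (gp a)) (hfin a) (hδ a)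
    rwa [measureReal_def, gb_vol hK, ENNReal.toReal_ofReal hv0.le] at h1
  have hbox' : ∀ a : Fin d → Fin K, ∫ x in gb a, (h x - h (gp a)) =
      (∫ x in gb a, h x) - v * h (gp a) := by
    intro a
    rw [integral_sub (hIntg a) (integrableOn_const (hfin a).ne), setIntegral_const, measureReal_def,
      gb_vol hK, ENNReal.toReal_ofReal hv0.le, smul_eq_mul]
  have hvK : v * K ^ d = (2 * Real.pi) ^ d := by
    rw [hv, ← mul_pow]; congr 1; field_simp
  have hav : av (fun a : Fin d → Fin K => h (gp a)) =
      ((2 * Real.pi) ^ d)⁻¹ * ∑ a : Fin d → Fin K, v * h (gp a) := by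
    unfold av
    rw [← Finset.mul_sum, ← hvK]
    simp only [Fintype.card_pi, Fintype.card_fin, Finset.prod_const, Finset.card_univ]
    push_cast
    field_simp
  rw [hJ, hav, ← mul_sub, ← Finset.sum_sub_distrib, abs_mul, abs_of_pos (by positivity)]
  rw [inv_mul_le_iff₀ (by positivity)]
  refine (Finset.abs_sum_le_sum_abs _ _).trans ?_
  calc _ ≤ ∑ a : Fin d → Fin K, δ * v := Finset.sum_le_sum fun a _ => by
        rw [← hbox' a]; exact hbox a
    _ = _ := by
        simp only [Finset.sum_const, Finset.card_univ, Fintype.card_pi, Fintype.card_fin,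
          Finset.prod_const, nsmul_eq_mul]
        rw [← hvK]; push_cast; ring

/-- Characters. -/
def ee {d : ℕ} (k : Fin d → ℤ) (x : Fin d → ℝ) : ℂ :=
  Complex.exp (Complex.I * ∑ j, (k j : ℂ) * (x j : ℂ))

theorem ee_eq {d : ℕ} (k : Fin d → ℤ) (x : Fin d → ℝ) :
    ee k x = Complex.exp (Complex.I * ((∑ j, (k j : ℝ) * x j : ℝ) : ℂ)) := by
  unfold ee; push_cast; rfl

theorem ee_norm {d : ℕ} (k : Fin d → ℤ) (x : Fin d → ℝ) : ‖ee k x‖ = 1 := by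
  rw [ee_eq, Complex.norm_exp_I_mul_ofReal]

theorem ee_lip {d : ℕ} (k : Fin d → ℤ) (x y : Fin d → ℝ) :
    ‖ee k x - ee k y‖ ≤ ∑ j, |(k j : ℝ)| * |x j - y j| := by
  have h : ee k x - ee k y = ee k y * (Complex.exp (Complex.I *
      ((∑ j, (k j : ℝ) * (x j - y j) : ℝ) : ℂ)) - 1) := by
    rw [ee_eq, ee_eq, mul_sub, ← Complex.exp_add, mul_one, ← mul_add, ← Complex.ofReal_add,
      ← Finset.sum_add_distrib]
    congr 5
    funext j
    ring
  rw [h, norm_mul, ee_norm, one_mul]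
  refine (Real.norm_exp_I_mul_ofReal_sub_one_le).trans ?_
  rw [Real.norm_eq_abs]
  refine (Finset.abs_sum_le_sum_abs _ _).trans (le_of_eq ?_)
  simp only [abs_mul]

theorem geom_zero (K : ℕ) (n : ℤ) (hn : n ≠ 0) (hnK : |n| < K) :
    ∑ a : Fin K, Complex.exp (Complex.I * ((n : ℂ) * ((2 * Real.pi / K * ((a : ℕ) : ℝ) : ℝ) : ℂ))) = 0 := by
  have hK : (K : ℂ) ≠ 0 := by
    intro h
    have : K = 0 := by exact_mod_cast h
    subst this
    simp at hnK
    exact absurd hnK (not_lt.2 (abs_nonneg n))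
  set z : ℂ := Complex.exp (n * (2 * Real.pi * Complex.I) / K) with hz
  have h1 : ∀ a : Fin K, Complex.exp (Complex.I * ((n : ℂ) *
      ((2 * Real.pi / K * ((a : ℕ) : ℝ) : ℝ) : ℂ))) = z ^ (a : ℕ) := by
    intro a
    rw [hz, ← Complex.exp_nat_mul]
    congr 1
    push_cast
    ring
  simp only [h1]
  rw [Fin.sum_univ_eq_sum_range (fun i => z ^ i) K]
  have hz1 : z ≠ 1 := by
    intro h
    rw [hz, Complex.exp_eq_one_iff] at h
    obtain ⟨p, hp⟩ := h
    have hpi : (2 * Real.pi * Complex.I : ℂ) ≠ 0 := Complex.two_pi_I_ne_zero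
    rw [div_eq_iff hK] at hp
    have h2 : (n : ℂ) = p * K := by
      apply mul_right_cancel₀ hpi
      rw [hp]; ring
    have h3 : n = p * K := by exact_mod_cast h2
    have h4 : (K : ℤ) ∣ n := ⟨p, by rw [h3]; ring⟩
    exact hn (Int.eq_zero_of_abs_lt_dvd h4 hnK)
  have hzK : z ^ K = 1 := by
    rw [hz, ← Complex.exp_nat_mul, mul_div_cancel₀ _ hK]
    exact Complex.exp_int_mul_two_pi_mul_I n
  rw [geom_sum_eq hz1, hzK, sub_self, zero_div]

theorem orth {d K : ℕ} (hK : 0 < K) (k l : Fin d → ℤ) (h : ∀ j, |k j - l j| < K) :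
    ∑ a : Fin d → Fin K, ee k (gp a) * (starRingEnd ℂ) (ee l (gp a)) =
      if k = l then (K : ℂ) ^ d else 0 := by
  have h1 : ∀ a : Fin d → Fin K, ee k (gp a) * (starRingEnd ℂ) (ee l (gp a)) =
      ∏ j, Complex.exp (Complex.I * (((k j - l j : ℤ) : ℂ) *
        ((2 * Real.pi / K * ((a j : ℕ) : ℝ) : ℝ) : ℂ))) := by
    intro a
    rw [ee_eq l, ← Complex.exp_conj, map_mul, Complex.conj_I, Complex.conj_ofReal, ee,
      ← Complex.exp_add, ← Complex.exp_sum]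
    congr 1
    unfold gp
    push_cast
    rw [neg_mul, ← sub_eq_add_neg, ← mul_sub, ← Finset.sum_sub_distrib, Finset.mul_sum]
    refine Finset.sum_congr rfl fun j _ => by ring
  simp only [h1]
  rw [← Fintype.piFinset_univ, ← Finset.prod_univ_sum (fun _ => Finset.univ) (fun j (a : Fin K) =>
    Complex.exp (Complex.I * (((k j - l j : ℤ) : ℂ) *
        ((2 * Real.pi / K * ((a : ℕ) : ℝ) : ℝ) : ℂ))))]
  split_ifs with hkl
  · subst hkl
    simp
  · obtain ⟨j, hj⟩ := Function.ne_iff.1 hkl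
    exact Finset.prod_eq_zero (Finset.mem_univ j)
      (geom_zero K (k j - l j) (sub_ne_zero.2 hj) (h j))

end Part8

theorem av_snd {β : Type} [Fintype β] (n : ℕ) (hn : 0 < n) (g : β → ℝ) :
    av (fun p : Fin n × β => g p.2) = av g := by
  have : (n : ℝ) ≠ 0 := by positivity
  unfold av
  rw [Fintype.sum_prod_type]
  simp only [Finset.sum_const, Finset.card_univ, Fintype.card_fin, nsmul_eq_mul, Fintype.card_prod]
  push_cast
  rw [mul_div_mul_left _ _ this]

theorem grid_l2 {d K : ℕ} (hK : 0 < K) (Q : Finset (Fin d → ℤ))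
    (h : ∀ k ∈ Q, ∀ l ∈ Q, ∀ j, |k j - l j| < K) (c : ↥Q → ℂ) :
    av (fun a : Fin d → Fin K => ‖ev (fun (k : ↥Q) => ee k.1) c (gp a)‖ ^ 2) = nrm2 c := by
  have h0 : ∀ y, ((‖ev (fun (k : ↥Q) => ee k.1) c y‖ ^ 2 : ℝ) : ℂ) =
      ∑ k, ∑ l, c k * (starRingEnd ℂ) (c l) * (ee k.1 y * (starRingEnd ℂ) (ee l.1 y)) := by
    intro y
    rw [← Complex.normSq_eq_norm_sq, ← Complex.mul_conj]
    unfold ev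
    rw [map_sum, Finset.sum_mul_sum]
    refine Finset.sum_congr rfl fun k _ => Finset.sum_congr rfl fun l _ => ?_
    rw [map_mul]; ring
  have hKd : ((K : ℝ) ^ d) ≠ 0 := by positivity
  unfold av
  rw [div_eq_iff (by simp [hK.ne'])]
  apply Complex.ofReal_injective
  rw [Complex.ofReal_sum]
  simp only [h0]
  rw [Finset.sum_comm]
  simp only [Fintype.card_pi, Fintype.card_fin, Finset.prod_const, Finset.card_univ]
  unfold nrm2
  rw [Finset.sum_mul, Complex.ofReal_sum]
  refine Finset.sum_congr rfl fun k _ => ?_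
  rw [Finset.sum_comm]
  simp only [← Finset.mul_sum]
  have h1 : ∀ l : ↥Q, ∑ a : Fin d → Fin K, ee k.1 (gp a) * (starRingEnd ℂ) (ee l.1 (gp a)) =
      if k = l then (K : ℂ) ^ d else 0 := by
    intro l
    rw [orth hK k.1 l.1 (h _ k.2 _ l.2)]
    simp only [Subtype.ext_iff]
  simp only [h1]
  simp only [mul_ite, mul_zero, Finset.sum_ite_eq, Finset.mem_univ, if_true]
  rw [Complex.mul_conj, Complex.normSq_eq_norm_sq]
  push_cast
  ring

theorem ee_cont {d : ℕ} (k : Fin d → ℤ) : Continuous (ee k) := by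
  unfold ee
  fun_prop

theorem grid_start (q : ℝ) (hq1 : 1 ≤ q) (hq2 : q < 2) (d : ℕ) (Q : Finset (Fin d → ℤ))
    (hQ : 0 < Q.card) : ∃ s : ℕ,
    (∀ c : ↥Q → ℂ, av (fun a : Fin d → Fin (2 ^ s) =>
      ‖ev (fun (k : ↥Q) => ee k.1) c (gp a)‖ ^ 2) = nrm2 c) ∧
    ∀ c : ↥Q → ℂ,
      1 / 2 * (∫ x, ‖ev (fun (k : ↥Q) => ee k.1) c x‖ ^ q ∂(torusMeasure d)) ≤
        av (fun a : Fin d → Fin (2 ^ s) => ‖ev (fun (k : ↥Q) => ee k.1) c (gp a)‖ ^ q) ∧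
      av (fun a : Fin d → Fin (2 ^ s) => ‖ev (fun (k : ↥Q) => ee k.1) c (gp a)‖ ^ q) ≤
        2 * (∫ x, ‖ev (fun (k : ↥Q) => ee k.1) c x‖ ^ q ∂(torusMeasure d)) := by
  -- a bound for all frequencies
  set B : ℕ := ∑ k ∈ Q, ∑ j, (k j).natAbs with hB
  have hBk : ∀ k ∈ Q, ∑ j, (k j).natAbs ≤ B := fun k hk =>
    Finset.single_le_sum (f := fun k : Fin d → ℤ => ∑ j, (k j).natAbs) (fun _ _ => Nat.zero_le _) hk
  have hBj : ∀ k ∈ Q, ∀ j, (k j).natAbs ≤ B := fun k hk j =>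
    (Finset.single_le_sum (f := fun j => (k j).natAbs) (fun _ _ => Nat.zero_le _)
      (Finset.mem_univ j)).trans (hBk k hk)
  set N := Q.card with hN
  have hNr : (1 : ℝ) ≤ N := by exact_mod_cast hQ
  set s : ℕ := 2 * B + 48 * N ^ 2 * B with hs
  refine ⟨s, ?_⟩
  set K : ℕ := 2 ^ s with hK
  have hsK : s < K := Nat.lt_two_pow_self
  have hK0 : 0 < K := by positivity
  have hKr : (0 : ℝ) < K := by exact_mod_cast hK0
  have hl2 := grid_l2 hK0 Q (fun k hk l hl j => by
    have h1 := hBj k hk j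
    have h2 := hBj l hl j
    have h3 : 2 * B ≤ s := by rw [hs]; exact Nat.le_add_right _ _
    rw [abs_lt]
    omega)
  refine ⟨hl2, fun c => ?_⟩
  set e : ↥Q → (Fin d → ℝ) → ℂ := fun k => ee k.1 with he
  have he1 : ∀ k x, ‖e k x‖ ≤ 1 := fun k x => (ee_norm _ _).le
  have hcard : Fintype.card ↥Q = N := by simp [hN]
  set t : ℝ := √(nrm2 c) with ht
  have ht0 : 0 ≤ t := Real.sqrt_nonneg _
  have ht2 : t ^ 2 = nrm2 c := Real.sq_sqrt (nrm2_nonneg c)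
  have hck : ∀ k, ‖c k‖ ≤ t := fun k => Real.le_sqrt_of_sq_le
    (Finset.single_le_sum (f := fun k => ‖c k‖ ^ 2) (fun _ _ => by positivity) (Finset.mem_univ k))
  set W : ℝ := √N * t with hW
  have hW0 : 0 ≤ W := by positivity
  have hsup : ∀ x, ‖ev e c x‖ ≤ W := by
    intro x
    have h1 := ev_sq_le e he1 c x
    refine (sq_le_sq₀ (norm_nonneg _) hW0).1 ?_
    rw [hW, mul_pow, Real.sq_sqrt (by positivity), ht2, ← hcard]
    exact h1
  have hcont : Continuous (fun x => ‖ev e c x‖ ^ q) := by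
    have : Continuous (fun x => ev e c x) := by
      unfold ev
      exact continuous_finsetSum _ fun k _ => continuous_const.mul (ee_cont k.1)
    exact this.norm.rpow_const fun _ => Or.inr (by linarith)
  have hpi := Real.pi_pos
  have hlip : ∀ a : Fin d → Fin K, ∀ x ∈ gb a, ‖ev e c x - ev e c (gp a)‖ ≤
      N * (t * (B * (2 * Real.pi / K))) := by
    intro a x hx
    have h1 : ev e c x - ev e c (gp a) = ∑ k, c k * (e k x - e k (gp a)) := by
      unfold ev
      rw [← Finset.sum_sub_distrib]
      exact Finset.sum_congr rfl fun k _ => by ring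
    rw [h1]
    refine (norm_sum_le _ _).trans ?_
    calc _ ≤ ∑ k : ↥Q, (t * (B * (2 * Real.pi / K))) := by
          refine Finset.sum_le_sum fun k _ => ?_
          rw [norm_mul]
          refine mul_le_mul (hck k) ?_ (norm_nonneg _) ht0
          refine (ee_lip k.1 x (gp a)).trans ?_
          calc _ ≤ ∑ j, ((k.1 j).natAbs : ℝ) * (2 * Real.pi / K) := by
                refine Finset.sum_le_sum fun j _ => ?_
                have hx' := hx j trivial
                rw [Nat.cast_natAbs, Int.cast_abs]
                refine mul_le_mul_of_nonneg_left ?_ (abs_nonneg _)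
                rw [abs_le]
                unfold gp
                have hp : 0 < 2 * Real.pi / K := by positivity
                constructor
                · linarith [hx'.1]
                · linarith [hx'.2]
            _ ≤ _ := by
                rw [← Finset.sum_mul]
                gcongr
                exact_mod_cast hBk k.1 k.2
      _ = _ := by
          rw [Finset.sum_const, Finset.card_univ, hcard, nsmul_eq_mul]
  set A : ℝ := av (fun a : Fin d → Fin K => ‖ev e c (gp a)‖ ^ q) with hA
  have hA0 : 0 ≤ A := av_nonneg fun _ => by positivity
  have hδ := riemann hK0 (fun x => ‖ev e c x‖ ^ q) hcont
    (2 * W ^ (q - 1) * (N * (t * (B * (2 * Real.pi / K))))) (fun a x hx => by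
      refine (rpow_diff q hq1 hq2 _ _ W (norm_nonneg _) (norm_nonneg _) (hsup _) (hsup _)).trans ?_
      have h1 : 0 ≤ W ^ (q - 1) := by positivity
      refine mul_le_mul_of_nonneg_left ?_ (by positivity)
      exact (abs_norm_sub_norm_le _ _).trans (hlip a x hx))
  have hlow : t ^ 2 ≤ W ^ (2 - q) * A := by
    rw [ht2, ← hl2 c, hA, ← av_mul]
    refine av_mono fun a => ?_
    have h1 : ‖ev e c (gp a)‖ ^ 2 = ‖ev e c (gp a)‖ ^ (2 - q) * ‖ev e c (gp a)‖ ^ q := by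
      rw [← Real.rpow_add' (norm_nonneg _) (by norm_num)]
      norm_num
    rw [h1]
    refine mul_le_mul_of_nonneg_right ?_ (by positivity)
    exact Real.rpow_le_rpow (norm_nonneg _) (hsup _) (by linarith)
  have herr : 2 * W ^ (q - 1) * (N * (t * (B * (2 * Real.pi / K)))) ≤ 1 / 3 * A := by
    rcases ht0.eq_or_lt with h | h
    · rw [← h]; simp; exact hA0
    have hWpos : 0 < W := by positivity
    have hX : 0 < W ^ (2 - q) := by positivity
    have hsqN : √(N : ℝ) ≤ N := by
      rw [Real.sqrt_le_left (by linarith)]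
      nlinarith
    have hKs : 48 * (N : ℝ) ^ 2 * B ≤ K := by
      have : 48 * N ^ 2 * B ≤ K := le_trans (by rw [hs]; exact Nat.le_add_left _ _) hsK.le
      exact_mod_cast this
    have hWW : W ^ (2 - q) * W ^ (q - 1) = W := by
      rw [← Real.rpow_add hWpos]; ring_nf; exact Real.rpow_one W
    refine le_of_mul_le_mul_left ?_ hX
    calc W ^ (2 - q) * (2 * W ^ (q - 1) * (N * (t * (B * (2 * Real.pi / K)))))
        = (W ^ (2 - q) * W ^ (q - 1)) * (2 * (N * (t * (B * (2 * Real.pi / K))))) := by ring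
      _ = √N * t ^ 2 * (N * B * 4 * Real.pi / K) := by rw [hWW, hW]; ring
      _ ≤ N * t ^ 2 * (N * B * 4 * 4 / K) := by
          have := Real.pi_lt_four
          gcongr
      _ = t ^ 2 * (1 / 3) * ((48 * (N : ℝ) ^ 2 * B) / K) := by ring
      _ ≤ t ^ 2 * (1 / 3) * 1 := by
          have : (48 * (N : ℝ) ^ 2 * B) / K ≤ 1 := by rw [div_le_one hKr]; exact hKs
          gcongr
      _ ≤ _ := by linarith
  have hfin := abs_le.1 (hδ.trans herr)
  constructor <;> linarith [hfin.1, hfin.2]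

theorem final_aux (q : ℝ) (hq1 : 1 ≤ q) (hq2 : q < 2) : ∃ C1 : ℝ, 0 < C1 ∧
    ∀ (d : ℕ) (Q : Finset (Fin d → ℤ)) (_ : 0 < Q.card) (m : ℕ),
      C1 * Q.card * Real.log (2 * Q.card) ^ 2 ≤ m →
      ∃ ξ : Fin m → (Fin d → ℝ), (∀ j, ξ j ∈ torusCell d) ∧ ∀ c : ↥Q → ℂ,
        1 / 8 * (∫ x, ‖ev (fun (k : ↥Q) => ee k.1) c x‖ ^ q ∂(torusMeasure d)) ≤
          av (fun i => ‖ev (fun (k : ↥Q) => ee k.1) c (ξ i)‖ ^ q) ∧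
        av (fun i => ‖ev (fun (k : ↥Q) => ee k.1) c (ξ i)‖ ^ q) ≤
          5 * (∫ x, ‖ev (fun (k : ↥Q) => ee k.1) c x‖ ^ q ∂(torusMeasure d)) := by
  obtain ⟨C1, hC1, h⟩ := abstract_thm q hq1 hq2
  refine ⟨C1, hC1, ?_⟩
  intro d Q hQ m hm
  obtain ⟨s, hs2, hsq⟩ := grid_start q hq1 hq2 d Q hQ
  have hcQ : Fintype.card ↥Q = Q.card := by simp
  obtain ⟨X, hX⟩ := h ↥Q ↥(torusCell d) (fun k x => ee k.1 x.1) (fun k x => (ee_norm _ _).le)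
    (by rw [hcQ]; exact hQ)
    (fun c => ∫ x, ‖ev (fun (k : ↥Q) => ee k.1) c x‖ ^ q ∂(torusMeasure d))
    (fun n hn => by
      have hcard : Fintype.card (Fin (n * 2 ^ (s * d))) =
          Fintype.card (Fin n × (Fin d → Fin (2 ^ s))) := by
        simp [pow_mul]
      let f : Fin (n * 2 ^ (s * d)) ≃ Fin n × (Fin d → Fin (2 ^ s)) := Fintype.equivOfCardEq hcard
      have key : ∀ g : (Fin d → ℝ) → ℝ, av (fun i => g (gp (f i).2)) =
          av (fun a : Fin d → Fin (2 ^ s) => g (gp a)) := by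
        intro g
        rw [av_equiv f (fun p => g (gp p.2)), av_snd n hn (fun a => g (gp a))]
      refine ⟨s * d, fun i => ⟨gp (f i).2, gp_mem _⟩, fun c => ?_, fun c => ?_⟩
      · exact (key (fun x => ‖ev (fun (k : ↥Q) => ee k.1) c x‖ ^ 2)).trans (hs2 c)
      · have := key (fun x => ‖ev (fun (k : ↥Q) => ee k.1) c x‖ ^ q)
        have h2 := hsq c
        rw [← this] at h2
        exact h2) m (by rw [hcQ]; exact hm)
  exact ⟨fun i => (X i).1, fun i => (X i).2, hX⟩

/-- **Theorem 4.1 of the paper.** For `q ∈ [1,2)` and arbitrary finite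
`Q ⊂ ℤ^d`, sampling discretization of the `L_q` norm for `T(Q)` holds with
`m ≥ C1 |Q| (log(2|Q|))^{w(q)}` points, where `w(1) = 3` and `w(q) = 2` for `q ∈ (1,2)`. -/
theorem stmt_12 (q : ℝ) (hq1 : 1 ≤ q) (hq2 : q < 2) :
    ∃ C1 C2 C3 : ℝ, 0 < C1 ∧ 0 < C2 ∧ 0 < C3 ∧
      ∀ (d : ℕ) (Q : Finset (Fin d → ℤ)) (m : ℕ),
        (m : ℝ) ≥ C1 * Q.card *
          (Real.log (2 * Q.card)) ^ (if q = 1 then (3 : ℝ) else 2) →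
        ∃ ξ : Fin m → (Fin d → ℝ), (∀ j, ξ j ∈ torusCell d) ∧
          ∀ f : (Fin d → ℝ) → ℂ,
            (∃ c : (Fin d → ℤ) → ℂ, ∀ x, f x = ∑ k ∈ Q,
                c k * Complex.exp (Complex.I * ∑ j, (k j : ℂ) * (x j : ℂ))) →
            C2 * torusLq d q f ^ q ≤ (1 / m : ℝ) * ∑ j, ‖f (ξ j)‖ ^ q ∧
            (1 / m : ℝ) * ∑ j, ‖f (ξ j)‖ ^ q ≤ C3 * torusLq d q f ^ q := by
  obtain ⟨C1, hC1, h⟩ := final_aux q hq1 hq2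
  refine ⟨2 * C1, 1 / 8, 5, by positivity, by norm_num, by norm_num, ?_⟩
  intro d Q m hm
  have hq0 : q ≠ 0 := by linarith
  have hLq : ∀ f : (Fin d → ℝ) → ℂ, torusLq d q f ^ q = ∫ x, ‖f x‖ ^ q ∂(torusMeasure d) := by
    intro f
    unfold torusLq
    rw [← Real.rpow_mul (integral_nonneg fun _ => by positivity), one_div_mul_cancel hq0,
      Real.rpow_one]
  simp only [hLq]
  rcases Nat.eq_zero_or_pos Q.card with h0 | hQ
  · rw [Finset.card_eq_zero] at h0
    subst h0
    refine ⟨fun _ => 0, fun j i _ => ⟨le_rfl, by simpa using Real.pi_pos⟩, ?_⟩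
    rintro f ⟨c, hc⟩
    have hf : ∀ x, f x = 0 := fun x => by rw [hc x]; simp
    simp [hf, Real.zero_rpow hq0]
  · have hNr : (1 : ℝ) ≤ Q.card := by exact_mod_cast hQ
    have hL : 1 / 2 ≤ Real.log (2 * Q.card) := by
      have h1 : Real.log 2 ≤ Real.log (2 * Q.card) := Real.log_le_log (by norm_num) (by linarith)
      linarith [Real.log_two_gt_d9]
    have hm' : C1 * Q.card * Real.log (2 * Q.card) ^ 2 ≤ m := by
      refine le_trans ?_ hm
      have h1 : Real.log (2 * Q.card) ^ 2 ≤
          2 * Real.log (2 * Q.card) ^ (if q = 1 then (3 : ℝ) else 2) := by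
        set L := Real.log (2 * Q.card)
        have hL2 : 0 ≤ L ^ 2 := by positivity
        split_ifs
        · rw [show (3 : ℝ) = ((3 : ℕ) : ℝ) by norm_num, Real.rpow_natCast]
          nlinarith
        · rw [Real.rpow_ofNat]
          linarith
      calc _ ≤ C1 * Q.card * (2 * Real.log (2 * Q.card) ^ (if q = 1 then (3 : ℝ) else 2)) := by
            gcongr
        _ = _ := by ring
    obtain ⟨ξ, hξ, hc⟩ := h d Q hQ m hm'
    refine ⟨ξ, hξ, ?_⟩
    rintro f ⟨c, hf⟩
    have hfe : ∀ x, f x = ev (fun (k : ↥Q) => ee k.1) (fun k => c k.1) x := by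
      intro x
      rw [hf x, ← Finset.sum_coe_sort]
      rfl
    simp only [hfe]
    have h1 := hc (fun k => c k.1)
    have h2 : ∀ g : Fin m → ℝ, av g = (1 / m : ℝ) * ∑ j, g j := by
      intro g
      unfold av
      rw [Fintype.card_fin]; ring
    simp only [h2] at h1
    exact h1
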